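/- arXiv:1710.08507 — 3 statements merged into one kernel-verified Lean document; each statement's English description precedes it below -/
import Mathlib

section
/- For all nonnegative integers k, r, and n, the number of pairs (λ*, π*) with λ* ∈ O_k*, π* ∈ O_{k+r}*, and |λ*| + |π*| = n equals the number of pairs (λ, π) with λ ∈ P_k, π ∈ P_{≤(k+r)}, and 4|λ| + 4|π| + 2r = n. -/
/-- A partition is a finite multiset of positive integers. -/
def IsPartition (m : Multiset ℕ) : Prop := ∀ x ∈ m, 0 < x

/-- The largest even part of a partition (0 if there are no even parts). -/
def lep (m : Multiset ℕ) : ℕ := (m.filter (fun x => Even x)).sup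

/-- `EO*`: every even part is smaller than every odd part, every part other than the
largest even part appears an even number of times, and the largest even part appears
an odd number of times. -/
def EOStar (m : Multiset ℕ) : Prop :=
  IsPartition m ∧
  (∀ x ∈ m, ∀ y ∈ m, Even x → Odd y → x < y) ∧
  (∀ x ∈ m, x ≠ lep m → Even (m.count x)) ∧
  (∀ x ∈ m, x = lep m → Odd (m.count x))

/-- `E*`: partitions into even parts where each distinct part appears an even number of times. -/
def EStar (m : Multiset ℕ) : Prop :=
  IsPartition m ∧ (∀ x ∈ m, Even x) ∧ ∀ x : ℕ, Even (m.count x)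

/-- `O_k*`: partitions into odd parts with exactly `2k` parts where each distinct part
appears an even number of times. -/
def OStar (k : ℕ) (m : Multiset ℕ) : Prop :=
  IsPartition m ∧ (∀ x ∈ m, Odd x) ∧ Multiset.card m = 2 * k ∧ ∀ x : ℕ, Even (m.count x)

/-- `Q_{k,r}`: partitions with a `(k+r+1) × k` Durfee rectangle whose largest part below
the rectangle is `< k+r+1`; equivalently, exactly `k` parts are `≥ k+r+1`. -/
def QSet (k r : ℕ) (m : Multiset ℕ) : Prop :=
  IsPartition m ∧ Multiset.card (m.filter (fun x => k + r + 1 ≤ x)) = k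

/-- `EO*_{k,r}`: partitions in `EO*` with exactly `2k` odd parts and largest even part `2k+2r`. -/
def EOkr (k r : ℕ) (m : Multiset ℕ) : Prop :=
  EOStar m ∧ Multiset.card (m.filter (fun x => Odd x)) = 2 * k ∧ lep m = 2 * k + 2 * r

/-- The even-odd crank: largest even part minus the number of odd parts. -/
def eoc (m : Multiset ℕ) : ℤ :=
  (lep m : ℤ) - (Multiset.card (m.filter (fun x => Odd x)) : ℤ)

/-- The conjugate partition: its `i`-th part is the number of parts that are `≥ i`. -/
def conjugate (m : Multiset ℕ) : Multiset ℕ :=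
  (Multiset.range m.sup).map (fun i => Multiset.card (m.filter (fun x => i + 1 ≤ x)))

/-- An overpartition: a partition together with a set of overlined part values, which must
be a subset of the distinct part values. -/
def IsOverpartition (p : Multiset ℕ × Finset ℕ) : Prop :=
  IsPartition p.1 ∧ p.2 ⊆ p.1.toFinset

theorem Multiset.sum_map_mul_add_const (a c : ℕ) (b : Multiset ℕ) :
    (b.map (fun x => a * x + c)).sum = a * b.sum + c * Multiset.card b := by
  induction b using Multiset.induction_on with
  | empty => simp
  | cons x b ih => simp only [map_cons, sum_cons, card_cons, ih]; ring

/-- The conjugate of a partition with parts at most `k`, padded with zeros to exactly `k` parts. -/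
def paddedConjugate : ℕ → Multiset ℕ → Multiset ℕ
  | 0, _ => 0
  | k + 1, m =>
    (0 ::ₘ paddedConjugate k (m.filter (fun x => x ≤ k))).map (fun x => m.count (k + 1) + x)

theorem card_paddedConjugate (k : ℕ) (m : Multiset ℕ) :
    Multiset.card (paddedConjugate k m) = k := by
  induction k generalizing m with
  | zero => rfl
  | succ k ih => simp [paddedConjugate, ih]

theorem eq_replicate_add_filter_le {k : ℕ} {m : Multiset ℕ} (hm : ∀ x ∈ m, x ≤ k + 1) :
    m = Multiset.replicate (m.count (k + 1)) (k + 1) + m.filter (fun x => x ≤ k) := by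
  rw [← Multiset.filter_eq']
  conv_lhs => rw [← Multiset.filter_add_not (fun x => x = k + 1) m]
  congr 1
  refine Multiset.filter_congr fun x hx => ?_
  have := hm x hx
  omega

theorem sum_paddedConjugate {k : ℕ} {m : Multiset ℕ} (hm : IsPartition m)
    (hk : ∀ x ∈ m, x ≤ k) : (paddedConjugate k m).sum = m.sum := by
  induction k generalizing m with
  | zero =>
    have : m = 0 := Multiset.eq_zero_of_forall_notMem fun x hx => by
      have := hm x hx
      have := hk x hx
      omega
    simp [paddedConjugate, this]
  | succ k ih =>
    have h := ih (m := m.filter (fun x => x ≤ k))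
      (fun x hx => hm x (Multiset.mem_of_mem_filter hx))
      (fun x hx => (Multiset.mem_filter.1 hx).2)
    have hs := congrArg Multiset.sum (eq_replicate_add_filter_le hk)
    rw [Multiset.sum_add, Multiset.sum_replicate, smul_eq_mul] at hs
    rw [hs, ← h]
    have h2 := Multiset.sum_map_mul_add_const 1 (m.count (k + 1))
      (0 ::ₘ paddedConjugate k (m.filter (fun x => x ≤ k)))
    simp only [one_mul, add_comm _ (m.count (k + 1)), Multiset.sum_cons, Multiset.card_cons,
      card_paddedConjugate, zero_add] at h2
    rw [paddedConjugate, h2, add_comm]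

theorem injOn_paddedConjugate (k : ℕ) :
    Set.InjOn (paddedConjugate k) {m | IsPartition m ∧ ∀ x ∈ m, x ≤ k} := by
  induction k with
  | zero =>
    have h0 : ∀ m : Multiset ℕ, (IsPartition m ∧ ∀ x ∈ m, x ≤ 0) → m = 0 := fun m hm =>
      Multiset.eq_zero_of_forall_notMem fun x hx => by
        have := hm.1 x hx
        have := hm.2 x hx
        omega
    intro m hm m' hm' _
    rw [h0 m hm, h0 m' hm']
  | succ k ih =>
    intro m hm m' hm' h
    have key : ∀ l l' : Multiset ℕ, paddedConjugate (k + 1) l = paddedConjugate (k + 1) l' →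
        l'.count (k + 1) ≤ l.count (k + 1) := by
      intro l l' hl
      have h1 : l.count (k + 1) ∈ paddedConjugate (k + 1) l := by simp [paddedConjugate]
      rw [hl, paddedConjugate, Multiset.mem_map] at h1
      obtain ⟨x, -, hx⟩ := h1
      omega
    have hc : m.count (k + 1) = m'.count (k + 1) := le_antisymm (key _ _ h.symm) (key _ _ h)
    rw [paddedConjugate, paddedConjugate, hc] at h
    have h2 := (Multiset.cons_inj_right 0).1
      (Multiset.map_injective (add_right_injective (m'.count (k + 1))) h)
    have h3 := ih
      ⟨fun x hx => hm.1 x (Multiset.mem_of_mem_filter hx), fun x hx => (Multiset.mem_filter.1 hx).2⟩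
      ⟨fun x hx => hm'.1 x (Multiset.mem_of_mem_filter hx), fun x hx => (Multiset.mem_filter.1 hx).2⟩
      h2
    rw [eq_replicate_add_filter_le hm.2, eq_replicate_add_filter_le hm'.2, hc, h3]

theorem surjOn_paddedConjugate (k : ℕ) :
    Set.SurjOn (paddedConjugate k) {m | IsPartition m ∧ ∀ x ∈ m, x ≤ k}
      {b | Multiset.card b = k} := by
  induction k with
  | zero =>
    intro b hb
    exact ⟨0, by simp [IsPartition], (Multiset.card_eq_zero.1 hb).symm⟩
  | succ k ih =>
    intro b hb
    have hb' : Multiset.card b = k + 1 := hb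
    obtain ⟨c, hc, hmin⟩ : ∃ c ∈ b, ∀ x ∈ b, c ≤ x := by
      obtain ⟨y, hy⟩ := Multiset.card_pos_iff_exists_mem.1 (by omega : 0 < Multiset.card b)
      have hne : ∃ c, c ∈ b := ⟨y, hy⟩
      classical
      exact ⟨Nat.find hne, Nat.find_spec hne, fun x hx => Nat.find_min' hne hx⟩
    obtain ⟨t, rfl⟩ := Multiset.exists_cons_of_mem hc
    obtain ⟨m, ⟨hm, hmk⟩, hmt⟩ := ih (a := t.map (fun x => x - c)) (by simpa using hb')
    have hcount : m.count (k + 1) = 0 := Multiset.count_eq_zero.2 fun h => by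
      have := hmk _ h
      omega
    refine ⟨Multiset.replicate c (k + 1) + m, ⟨?_, ?_⟩, ?_⟩
    · intro x hx
      rcases Multiset.mem_add.1 hx with h | h
      · rw [Multiset.eq_of_mem_replicate h]; omega
      · exact hm x h
    · intro x hx
      rcases Multiset.mem_add.1 hx with h | h
      · rw [Multiset.eq_of_mem_replicate h]
      · exact (hmk x h).trans (Nat.le_succ k)
    · have hfilter : (Multiset.replicate c (k + 1) + m).filter (fun x => x ≤ k) = m := by
        rw [Multiset.filter_add, Multiset.filter_eq_self.2 hmk, Multiset.filter_eq_nil.2, zero_add]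
        intro x hx
        rw [Multiset.eq_of_mem_replicate hx]
        omega
      rw [paddedConjugate, hfilter, hmt, Multiset.count_add, hcount, Multiset.count_replicate_self,
        Multiset.map_cons, Multiset.map_map, add_zero, add_zero]
      congr 1
      conv_rhs => rw [← Multiset.map_id t]
      refine Multiset.map_congr rfl fun x hx => ?_
      have := hmin x (Multiset.mem_cons_of_mem hx)
      simp only [Function.comp_apply, id]
      omega

theorem bijOn_paddedConjugate (k : ℕ) :
    Set.BijOn (paddedConjugate k) {m | IsPartition m ∧ ∀ x ∈ m, x ≤ k}
      {b | Multiset.card b = k} :=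
  ⟨fun m _ => card_paddedConjugate k m, injOn_paddedConjugate k, surjOn_paddedConjugate k⟩

/-- Replace each `x` by two copies of the odd number `2 * x + 1`. -/
def doubleOdd (b : Multiset ℕ) : Multiset ℕ := 2 • b.map (fun x => 2 * x + 1)

theorem sum_doubleOdd (b : Multiset ℕ) :
    (doubleOdd b).sum = 4 * b.sum + 2 * Multiset.card b := by
  rw [doubleOdd, Multiset.sum_nsmul, Multiset.sum_map_mul_add_const, smul_eq_mul]
  ring

theorem exists_two_nsmul_eq {α : Type*} [DecidableEq α] {m : Multiset α}
    (hm : ∀ x, Even (m.count x)) : ∃ b : Multiset α, 2 • b = m := by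
  refine ⟨∑ a ∈ m.toFinset, (m.count a / 2) • {a}, ?_⟩
  conv_rhs => rw [← Multiset.toFinset_sum_count_nsmul_eq m]
  rw [Finset.smul_sum]
  refine Finset.sum_congr rfl fun a _ => ?_
  rw [smul_smul, Nat.two_mul_div_two_of_even (hm a)]

theorem bijOn_doubleOdd (k : ℕ) :
    Set.BijOn doubleOdd {b | Multiset.card b = k} {m | OStar k m} := by
  refine ⟨?_, ?_, ?_⟩
  · intro b hb
    have hodd : ∀ x ∈ doubleOdd b, Odd x := by
      intro x hx
      obtain ⟨y, -, rfl⟩ := Multiset.mem_map.1 (Multiset.mem_of_mem_nsmul hx)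
      exact ⟨y, rfl⟩
    refine ⟨fun x hx => (hodd x hx).pos, hodd, ?_, fun x => ?_⟩
    · have hb' : Multiset.card b = k := hb
      simp [doubleOdd, hb']
    · rw [doubleOdd, Multiset.count_nsmul]
      exact even_two_mul _
  · intro b _ b' _ h
    have hmap : b.map (fun x => 2 * x + 1) = b'.map (fun x => 2 * x + 1) := by
      ext x
      have := congrArg (Multiset.count x) h
      simp only [doubleOdd, Multiset.count_nsmul] at this
      omega
    refine Multiset.map_injective (fun x y hxy => ?_) hmap
    omega
  · rintro m ⟨-, hodd, hcard, heven⟩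
    obtain ⟨b, rfl⟩ := exists_two_nsmul_eq heven
    refine ⟨b.map (fun x => x / 2), ?_, ?_⟩
    · simpa using hcard
    · rw [doubleOdd, Multiset.map_map]
      congr 1
      conv_rhs => rw [← Multiset.map_id b]
      refine Multiset.map_congr rfl fun x hx => ?_
      obtain ⟨y, rfl⟩ := hodd x (by rw [two_nsmul]; exact Multiset.mem_add.2 (Or.inl hx))
      simp only [Function.comp_apply, id]
      omega

theorem mem_of_sup_eq {k : ℕ} (hk : k ≠ 0) {m : Multiset ℕ} (hm : m.sup = k) : k ∈ m := by
  by_contra h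
  have : m.sup ≤ k - 1 := Multiset.sup_le.2 fun x hx => by
    have h1 : x ≤ k := hm ▸ Multiset.le_sup hx
    have h2 : x ≠ k := fun e => h (e ▸ hx)
    omega
  omega

theorem sum_erase_sup (m : Multiset ℕ) : (m.erase m.sup).sum + m.sup = m.sum := by
  rcases eq_or_ne m.sup 0 with h | h
  · by_cases h0 : 0 ∈ m
    · rw [h, add_comm, Multiset.sum_erase h0]
    · rw [h, Multiset.erase_of_notMem h0, add_zero]
  · rw [add_comm, Multiset.sum_erase (mem_of_sup_eq h rfl)]

theorem bijOn_erase_sup (k : ℕ) :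
    Set.BijOn (fun m => m.erase k) {m : Multiset ℕ | IsPartition m ∧ m.sup = k}
      {m | IsPartition m ∧ ∀ x ∈ m, x ≤ k} := by
  refine ⟨?_, ?_, ?_⟩
  · rintro m ⟨hm, rfl⟩
    exact ⟨fun x hx => hm x (Multiset.mem_of_mem_erase hx),
      fun x hx => Multiset.le_sup (Multiset.mem_of_mem_erase hx)⟩
  · rintro m ⟨hm, hmk⟩ m' ⟨hm', hmk'⟩ h
    rcases eq_or_ne k 0 with rfl | hk
    · have h0 : ∀ l : Multiset ℕ, IsPartition l → (0 : ℕ) ∉ l := fun l hl h => (hl 0 h).false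
      simpa only [Multiset.erase_of_notMem (h0 _ hm), Multiset.erase_of_notMem (h0 _ hm')] using h
    · rw [← Multiset.cons_erase (mem_of_sup_eq hk hmk), ← Multiset.cons_erase (mem_of_sup_eq hk hmk')]
      exact congrArg _ h
  · rintro m ⟨hm, hmk⟩
    rcases eq_or_ne k 0 with rfl | hk
    · refine ⟨m, ⟨hm, Nat.le_zero.1 (Multiset.sup_le.2 hmk)⟩, ?_⟩
      exact Multiset.erase_of_notMem fun h => (hm 0 h).false
    · refine ⟨k ::ₘ m, ⟨fun x hx => ?_, ?_⟩, Multiset.erase_cons_head k m⟩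
      · rcases Multiset.mem_cons.1 hx with rfl | h
        · omega
        · exact hm x h
      · rw [Multiset.sup_cons]
        exact sup_eq_left.2 (Multiset.sup_le.2 hmk)

/-- Lemma 2: for all nonnegative integers `k`, `r`, `n`, the number of pairs
`(λ*, π*) ∈ O_k* × O_{k+r}*` with `|λ*| + |π*| = n` equals the number of pairs
`(λ, π) ∈ P_k × P_{≤ k+r}` with `4|λ| + 4|π| + 2r = n`. -/
theorem stmt1 (k r n : ℕ) :
    {p : Multiset ℕ × Multiset ℕ |
      OStar k p.1 ∧ OStar (k + r) p.2 ∧ p.1.sum + p.2.sum = n}.ncard =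
    {p : Multiset ℕ × Multiset ℕ |
      IsPartition p.1 ∧ p.1.sup = k ∧
      IsPartition p.2 ∧ (∀ x ∈ p.2, x ≤ k + r) ∧
      4 * p.1.sum + 4 * p.2.sum + 2 * r = n}.ncard := by
  have hF := (bijOn_doubleOdd k).comp ((bijOn_paddedConjugate k).comp (bijOn_erase_sup k))
  have hG := (bijOn_doubleOdd (k + r)).comp (bijOn_paddedConjugate (k + r))
  have sF : ∀ l : Multiset ℕ, IsPartition l → l.sup = k →
      (doubleOdd (paddedConjugate k (l.erase k))).sum + 2 * k = 4 * l.sum := by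
    intro l hl hk
    have h1 := (bijOn_erase_sup k).mapsTo ⟨hl, hk⟩
    have h2 := sum_erase_sup l
    rw [sum_doubleOdd, card_paddedConjugate, sum_paddedConjugate h1.1 h1.2]
    rw [hk] at h2
    omega
  have sG : ∀ l : Multiset ℕ, IsPartition l → (∀ x ∈ l, x ≤ k + r) →
      (doubleOdd (paddedConjugate (k + r) l)).sum = 4 * l.sum + 2 * (k + r) := by
    intro l hl hk
    rw [sum_doubleOdd, card_paddedConjugate, sum_paddedConjugate hl hk]
  symm
  refine Set.ncard_congr (fun p _ => (doubleOdd (paddedConjugate k (p.1.erase k)),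
    doubleOdd (paddedConjugate (k + r) p.2))) ?_ ?_ ?_
  · rintro ⟨l, q⟩ ⟨hl, hlk, hq, hqk, hn⟩
    refine ⟨hF.mapsTo ⟨hl, hlk⟩, hG.mapsTo ⟨hq, hqk⟩, ?_⟩
    have h1 := sF l hl hlk
    have h2 := sG q hq hqk
    simp only at hn ⊢
    omega
  · rintro ⟨l, q⟩ ⟨l', q'⟩ ⟨hl, hlk, hq, hqk, -⟩ ⟨hl', hlk', hq', hqk', -⟩ h
    obtain ⟨h1, h2⟩ := Prod.mk.inj h
    exact Prod.ext (hF.injOn ⟨hl, hlk⟩ ⟨hl', hlk'⟩ h1) (hG.injOn ⟨hq, hqk⟩ ⟨hq', hqk'⟩ h2)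
  · rintro ⟨a, b⟩ ⟨ha, hb, hn⟩
    obtain ⟨l, ⟨hl, hlk⟩, rfl⟩ := hF.surjOn ha
    obtain ⟨q, ⟨hq, hqk⟩, rfl⟩ := hG.surjOn hb
    refine ⟨(l, q), ⟨hl, hlk, hq, hqk, ?_⟩, rfl⟩
    have h1 := sF l hl hlk
    have h2 := sG q hq hqk
    simp only [Function.comp_apply] at hn ⊢
    omega
end

section
/- For all nonnegative integers r and n, the number of pairs (λ*, π*) with λ* ∈ O_k* and π* ∈ O_{k+r}* for some nonnegative integer k and |λ*| + |π*| = n equals the number of pairs (μ*, ν*) with μ* ∈ E*, ν* ∈ EO* with even-odd crank eoc(ν*) = 2r, and |μ*| + |ν*| = n. -/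
section QSeries

variable {R : Type*} [CommRing R] {Q : R} {K : ℕ} {a : ℕ → R}

theorem eventually_const_of_truncated (hQ : Q ^ K = 0)
    (ha : ∀ k, a (k + 1) = a k + Q ^ (k + 1) * a (k + 1)) (j : ℕ) : a (K + j) = a K := by
  induction j with
  | zero => rfl
  | succ j ih =>
    rw [← add_assoc, ha, pow_eq_zero_of_le (by omega) hQ, ih, zero_mul, add_zero]

theorem sum_mul_telescope (ha0 : a 0 = 1)
    (ha : ∀ k, a (k + 1) = a k + Q ^ (k + 1) * a (k + 1)) (r n : ℕ) :
    ∑ k ∈ Finset.range (n + 1), Q ^ k * a k * a (k + r) +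
      Q ^ (r + 1) * ∑ k ∈ Finset.range (n + 1), Q ^ k * a k * a (k + (r + 1)) =
      a n * a (n + r + 1) := by
  induction n with
  | zero =>
    have h := ha r
    simp only [zero_add, Finset.sum_range_one, ha0, pow_zero, one_mul]
    exact h.symm
  | succ n ih =>
    rw [Finset.sum_range_succ, Finset.sum_range_succ _ (n + 1)]
    have h1 := ha n
    have h2 := ha (n + r + 1)
    rw [show n + 1 + (r + 1) = n + r + 1 + 1 by ring, show n + 1 + r + 1 = n + r + 1 + 1 by ring,
      show n + 1 + r = n + r + 1 by ring]
    have e : Q ^ (r + 1) * Q ^ (n + 1) = Q ^ (n + r + 1 + 1) := by rw [← pow_add]; congr 1; ring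
    linear_combination ih - a (n + r + 1) * h1 - a (n + 1) * h2 +
      a (n + 1) * a (n + r + 1 + 1) * e

theorem durfee_sum_succ (ha : ∀ k, a (k + 1) = a k + Q ^ (k + 1) * a (k + 1)) (r n : ℕ) :
    ∑ k ∈ Finset.range n, Q ^ (k * (k + r + 1)) * a k * a (k + r) +
      Q ^ (r + 1) * ∑ k ∈ Finset.range n, Q ^ (k * (k + (r + 1) + 1)) * a k * a (k + (r + 1)) =
      ∑ k ∈ Finset.range n, Q ^ (k * (k + (r + 1))) * a k * a (k + (r + 1)) := by
  rw [Finset.mul_sum, ← Finset.sum_add_distrib]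
  refine Finset.sum_congr rfl fun k _ => ?_
  have h := ha (k + r)
  have e : Q ^ (r + 1) * Q ^ (k * (k + (r + 1) + 1)) =
      Q ^ (k * (k + r + 1)) * Q ^ (k + r + 1) := by
    rw [← pow_add, ← pow_add]; congr 1; ring
  rw [show k + (r + 1) = k + r + 1 by ring] at *
  linear_combination a k * a (k + r + 1) * e - Q ^ (k * (k + r + 1)) * a k * h

theorem durfee_sum (ha : ∀ k, a (k + 1) = a k + Q ^ (k + 1) * a (k + 1)) (r n : ℕ) :
    ∑ k ∈ Finset.range (n + 1), Q ^ (k * (k + r)) * a k * a (k + r) =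
      ∑ k ∈ Finset.range (n + 1), Q ^ (k * (k + r + 1)) * a k * a (k + r) +
      Q ^ (r + 1) * ∑ k ∈ Finset.range n, Q ^ (k * (k + (r + 1) + 1)) * a k * a (k + (r + 1)) := by
  rw [Finset.sum_range_succ', Finset.sum_range_succ' _ n, Finset.mul_sum, add_right_comm,
    ← Finset.sum_add_distrib]
  simp only [zero_mul]
  congr 1
  refine Finset.sum_congr rfl fun k _ => ?_
  have h := ha k
  have e1 : Q ^ ((k + 1) * (k + 1 + r + 1)) = Q ^ ((k + 1) * (k + 1 + r)) * Q ^ (k + 1) := by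
    rw [← pow_add]; congr 1
  have e2 : Q ^ (r + 1) * Q ^ (k * (k + (r + 1) + 1)) = Q ^ ((k + 1) * (k + 1 + r)) := by
    rw [← pow_add]; congr 1; ring
  rw [show k + (r + 1) = k + 1 + r by ring] at *
  linear_combination Q ^ ((k + 1) * (k + 1 + r)) * a (k + 1 + r) * h -
    a (k + 1) * a (k + 1 + r) * e1 - a k * a (k + 1 + r) * e2

theorem durfee_sum_eq (hQ : Q ^ K = 0) (ha0 : a 0 = 1)
    (ha : ∀ k, a (k + 1) = a k + Q ^ (k + 1) * a (k + 1)) (r : ℕ) :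
    ∑ k ∈ Finset.range (K + 1), Q ^ (k * (k + r)) * a k * a (k + r) = a K := by
  have step : ∀ r, ∑ k ∈ Finset.range (K + 1), Q ^ (k * (k + r)) * a k * a (k + r) =
      ∑ k ∈ Finset.range (K + 1), Q ^ (k * (k + (r + 1))) * a k * a (k + (r + 1)) := by
    intro r
    rw [durfee_sum ha, ← durfee_sum_succ ha r (K + 1), Finset.sum_range_succ _ K (M := R)]
    have : Q ^ (r + 1) * Q ^ (K * (K + (r + 1) + 1)) = 0 := by
      rw [← pow_add]
      exact pow_eq_zero_of_le (by nlinarith) hQ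
    rw [Finset.sum_range_succ (fun k => Q ^ (k * (k + (r + 1) + 1)) * a k * a (k + (r + 1))) K]
    linear_combination (-a K * a (K + (r + 1))) * this
  have shift : ∀ j, ∑ k ∈ Finset.range (K + 1), Q ^ (k * (k + r)) * a k * a (k + r) =
      ∑ k ∈ Finset.range (K + 1), Q ^ (k * (k + (r + j))) * a k * a (k + (r + j)) := by
    intro j
    induction j with
    | zero => rfl
    | succ j ih => rw [ih, step, add_assoc]
  rw [shift K, Finset.sum_range_succ', Finset.sum_eq_zero]
  · rw [zero_mul, pow_zero, ha0, zero_add, zero_add, one_mul, one_mul, add_comm r,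
      eventually_const_of_truncated hQ ha]
  · intro k _
    rw [pow_eq_zero_of_le (by nlinarith) hQ, zero_mul, zero_mul]

theorem sum_mul_eq_mul_durfee_sum (hQ : Q ^ K = 0) (ha0 : a 0 = 1)
    (ha : ∀ k, a (k + 1) = a k + Q ^ (k + 1) * a (k + 1)) (r : ℕ) :
    ∑ k ∈ Finset.range (K + 1), Q ^ k * a k * a (k + r) =
      a K * ∑ k ∈ Finset.range (K + 1), Q ^ (k * (k + r + 1)) * a k * a (k + r) := by
  suffices H : ∀ j r, K ≤ r + j → ∑ k ∈ Finset.range (K + 1), Q ^ k * a k * a (k + r) =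
      a K * ∑ k ∈ Finset.range (K + 1), Q ^ (k * (k + r + 1)) * a k * a (k + r) from
    H K r (by omega)
  have key : ∀ r, _ := fun r => sum_mul_telescope ha0 ha r K
  have key' : ∀ r, _ := fun r => durfee_sum_succ ha r (K + 1)
  intro j
  induction j with
  | zero =>
    intro r hr
    have h1 := key r
    have h2 := key' r
    rw [durfee_sum_eq hQ ha0 ha, pow_eq_zero_of_le (by omega) hQ, zero_mul,
      add_zero] at h2
    rw [pow_eq_zero_of_le (by omega) hQ, zero_mul, add_zero, add_assoc,
      eventually_const_of_truncated hQ ha] at h1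
    rw [h1, h2]
  | succ j ih =>
    intro r hr
    have h1 := key r
    have h2 := key' r
    rw [durfee_sum_eq hQ ha0 ha] at h2
    rw [add_assoc K, eventually_const_of_truncated hQ ha] at h1
    have h3 := ih (r + 1) (by omega)
    linear_combination h1 - a K * h2 - Q ^ (r + 1) * h3

end QSeries

section GeneratingFunction

open PowerSeries

variable {α β : Type*}

/-- `φ` is the generating function of the set `S` with respect to the weight `w`, all of whose
fibres on `S` are finite. -/
def HasGenFun (S : Set α) (w : α → ℕ) (φ : ℤ⟦X⟧) : Prop :=
  ∀ n, {x ∈ S | w x = n}.Finite ∧ coeff n φ = ({x ∈ S | w x = n}.ncard : ℤ)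

theorem exists_hasGenFun {S : Set α} {w : α → ℕ} (h : ∀ n, {x ∈ S | w x = n}.Finite) :
    ∃ φ, HasGenFun S w φ :=
  ⟨PowerSeries.mk fun n => ({x ∈ S | w x = n}.ncard : ℤ), fun n => ⟨h n, coeff_mk _ _⟩⟩

namespace HasGenFun

variable {S T : Set α} {w : α → ℕ} {φ ψ : ℤ⟦X⟧}

theorem unique (h : HasGenFun S w φ) (h' : HasGenFun S w ψ) : φ = ψ := by
  ext n
  rw [(h n).2, (h' n).2]

theorem empty (w : α → ℕ) : HasGenFun ∅ w 0 := fun n => by simp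

theorem singleton {x : α} (hx : w x = 0) : HasGenFun {x} w 1 := by
  intro n
  rcases eq_or_ne n 0 with rfl | hn
  · have : {y ∈ ({x} : Set α) | w y = 0} = {x} := by
      ext y
      simp only [Set.mem_singleton_iff, Set.mem_ofPred_eq, and_iff_left_iff_imp]
      rintro rfl
      exact hx
    rw [this]
    simp
  · have : {y ∈ ({x} : Set α) | w y = n} = ∅ := by
      ext y
      simp only [Set.mem_singleton_iff, Set.mem_ofPred_eq, Set.mem_empty_iff_false, iff_false]
      rintro ⟨rfl, h⟩
      omega
    rw [this]
    simp [coeff_one, hn]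

theorem union (h : HasGenFun S w φ) (h' : HasGenFun T w ψ) (hd : Disjoint S T) :
    HasGenFun (S ∪ T) w (φ + ψ) := by
  intro n
  have e : {x ∈ S ∪ T | w x = n} = {x ∈ S | w x = n} ∪ {x ∈ T | w x = n} := by
    ext x
    simp only [Set.mem_union, Set.mem_ofPred_eq]
    tauto
  rw [e, Set.ncard_union_eq _ (h n).1 (h' n).1, map_add, (h n).2, (h' n).2]
  · exact ⟨(h n).1.union (h' n).1, by push_cast; rfl⟩
  · exact hd.mono (Set.sep_subset _ _) (Set.sep_subset _ _)

theorem image {w' : β → ℕ} {f : α → β} {j : ℕ} (h : HasGenFun S w φ) (hf : Set.InjOn f S)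
    (hw : ∀ x ∈ S, w' (f x) = w x + j) : HasGenFun (f '' S) w' (X ^ j * φ) := by
  intro n
  rw [coeff_X_pow_mul']
  split_ifs with hj
  · have e : {y ∈ f '' S | w' y = n} = f '' {x ∈ S | w x = n - j} := by
      ext y
      constructor
      · rintro ⟨⟨x, hx, rfl⟩, hn⟩
        have := hw x hx
        exact ⟨x, ⟨hx, by omega⟩, rfl⟩
      · rintro ⟨x, ⟨hx, hn⟩, rfl⟩
        have := hw x hx
        exact ⟨⟨x, hx, rfl⟩, by omega⟩
    rw [e, (hf.mono (Set.sep_subset _ _)).ncard_image, (h _).2]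
    exact ⟨(h _).1.image f, rfl⟩
  · have e : {y ∈ f '' S | w' y = n} = ∅ := by
      ext y
      simp only [Set.mem_ofPred_eq, Set.mem_empty_iff_false, iff_false]
      rintro ⟨⟨x, hx, rfl⟩, hn⟩
      have := hw x hx
      omega
    rw [e]
    simp

theorem prod {T : Set β} {w' : β → ℕ} (h : HasGenFun S w φ) (h' : HasGenFun T w' ψ) :
    HasGenFun (S ×ˢ T) (fun p => w p.1 + w' p.2) (φ * ψ) := by
  intro n
  have e : {p ∈ S ×ˢ T | w p.1 + w' p.2 = n} =
      ⋃ i ∈ (Finset.HasAntidiagonal.antidiagonal n : Set (ℕ × ℕ)),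
        {x ∈ S | w x = i.1} ×ˢ {y ∈ T | w' y = i.2} := by
    ext ⟨x, y⟩
    simp only [Set.mem_ofPred_eq, Set.mem_prod, Set.mem_iUnion, Finset.mem_coe,
      Finset.HasAntidiagonal.mem_antidiagonal, exists_prop, Prod.exists]
    constructor
    · rintro ⟨⟨hx, hy⟩, hn⟩
      exact ⟨_, _, hn, ⟨hx, rfl⟩, hy, rfl⟩
    · rintro ⟨i, j, hn, ⟨hx, rfl⟩, hy, rfl⟩
      exact ⟨⟨hx, hy⟩, hn⟩
  have hfin : ∀ i ∈ (Finset.HasAntidiagonal.antidiagonal n : Set (ℕ × ℕ)),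
      ({x ∈ S | w x = i.1} ×ˢ {y ∈ T | w' y = i.2}).Finite :=
    fun i _ => (h i.1).1.prod (h' i.2).1
  rw [e]
  refine ⟨(Finset.finite_toSet _).biUnion hfin, ?_⟩
  rw [Set.Finite.ncard_biUnion (Finset.finite_toSet _) hfin, finsum_mem_coe_finset, coeff_mul,
    Nat.cast_sum]
  · refine Finset.sum_congr rfl fun i _ => ?_
    rw [Set.ncard_prod, (h i.1).2, (h' i.2).2, Nat.cast_mul]
  · rintro ⟨i, j⟩ _ ⟨i', j'⟩ _ hne
    rw [Function.onFun, Set.disjoint_left]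
    rintro ⟨x, y⟩ ⟨⟨_, hx⟩, _, hy⟩ ⟨⟨_, hx'⟩, _, hy'⟩
    simp only at hx hy hx' hy'
    exact hne (by rw [← hx, ← hy, hx', hy'])

theorem biUnion_lt {S : ℕ → Set α} {φ : ℕ → ℤ⟦X⟧} (h : ∀ k, HasGenFun (S k) w (φ k))
    (hd : ∀ i j x, x ∈ S i → x ∈ S j → i = j) (n : ℕ) :
    HasGenFun {x | ∃ k < n, x ∈ S k} w (∑ k ∈ Finset.range n, φ k) := by
  induction n with
  | zero => simpa using empty w
  | succ n ih =>
    have e : {x | ∃ k < n + 1, x ∈ S k} = {x | ∃ k < n, x ∈ S k} ∪ S n := by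
      ext x
      simp only [Set.mem_ofPred_eq, Set.mem_union, Nat.exists_lt_succ_right]
    rw [e, Finset.sum_range_succ]
    refine ih.union (h n) (Set.disjoint_left.2 ?_)
    rintro x ⟨k, hk, hx⟩ hx'
    exact hk.ne (hd _ _ _ hx hx')

end HasGenFun

end GeneratingFunction

section Multisets

open PowerSeries

theorem finite_card_le_sum_eq (k n : ℕ) :
    {s : Multiset ℕ | Multiset.card s ≤ k ∧ s.sum = n}.Finite := by
  refine (Set.finite_Iic (k • Multiset.range (n + 1))).subset ?_
  rintro s ⟨hk, hn⟩
  rw [Set.mem_Iic, Multiset.le_iff_count]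
  intro x
  by_cases hx : x ∈ s
  · have : x ≤ n := hn ▸ Multiset.le_sum_of_mem hx
    rw [Multiset.count_nsmul, Multiset.count_eq_one_of_mem (Multiset.nodup_range _)
      (Multiset.mem_range.2 (by omega)), mul_one]
    exact (Multiset.count_le_card x s).trans hk
  · simp [Multiset.count_eq_zero_of_notMem hx]

theorem IsPartition.card_le_sum {s : Multiset ℕ} (hs : IsPartition s) :
    Multiset.card s ≤ s.sum := by
  simpa using Multiset.card_nsmul_le_sum (a := 1) hs

/-- Multisets of natural numbers (zero allowed) of cardinality `k`. -/
def cardEq (k : ℕ) : Set (Multiset ℕ) := {s | Multiset.card s = k}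

/-- Partitions with all parts at most `k`. -/
def partsLE (k : ℕ) : Set (Multiset ℕ) := {s | ∀ x ∈ s, 1 ≤ x ∧ x ≤ k}

theorem finite_fiber_cardEq (k n : ℕ) : {s ∈ cardEq k | 4 * s.sum = n}.Finite := by
  refine (finite_card_le_sum_eq k (n / 4)).subset ?_
  rintro s ⟨hs, hn⟩
  exact ⟨le_of_eq hs, by omega⟩

theorem finite_fiber_partsLE (k n : ℕ) : {s ∈ partsLE k | 4 * s.sum = n}.Finite := by
  refine (finite_card_le_sum_eq (n / 4) (n / 4)).subset ?_
  rintro s ⟨hs, hn⟩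
  have := IsPartition.card_le_sum (s := s) fun x hx => (hs x hx).1
  exact ⟨by omega, by omega⟩

theorem exists_map_add_one {s : Multiset ℕ} (hs : 0 ∉ s) : ∃ t : Multiset ℕ, s = t.map (· + 1) := by
  refine ⟨s.map (· - 1), ?_⟩
  rw [Multiset.map_map]
  conv_lhs => rw [← Multiset.map_id s]
  refine Multiset.map_congr rfl fun x hx => ?_
  have : x ≠ 0 := fun h => hs (h ▸ hx)
  simp only [id, Function.comp]
  omega

theorem hasGenFun_cardEq_succ {k : ℕ} {φ ψ : ℤ⟦X⟧}
    (h : HasGenFun (cardEq k) (fun s => 4 * s.sum) φ)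
    (h' : HasGenFun (cardEq (k + 1)) (fun s => 4 * s.sum) ψ) :
    ψ = φ + (X ^ 4) ^ (k + 1) * ψ := by
  have e : cardEq (k + 1) =
      (fun s => (0 ::ₘ s : Multiset ℕ)) '' cardEq k ∪ Multiset.map (· + 1) '' cardEq (k + 1) := by
    ext s
    constructor
    · intro hs
      by_cases h0 : 0 ∈ s
      · obtain ⟨t, rfl⟩ := Multiset.exists_cons_of_mem h0
        refine Or.inl ⟨t, ?_, rfl⟩
        simpa [cardEq] using hs
      · obtain ⟨t, rfl⟩ := exists_map_add_one h0
        refine Or.inr ⟨t, ?_, rfl⟩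
        simpa [cardEq] using hs
    · rintro (⟨t, ht, rfl⟩ | ⟨t, ht, rfl⟩) <;> simpa [cardEq] using ht
  refine h'.unique ?_
  rw [← pow_mul]
  nth_rewrite 1 [e]
  refine HasGenFun.union ?_ ?_ (Set.disjoint_left.2 ?_)
  · simpa using h.image (j := 0) (w' := fun s => 4 * s.sum)
      (fun s _ t _ hst => Multiset.cons_inj_right 0 |>.1 hst) (by simp)
  · refine h'.image (Multiset.map_injective (add_left_injective 1)).injOn fun s hs => ?_
    rw [Multiset.sum_map_add]
    simp only [Multiset.map_id', Multiset.map_const', Multiset.sum_replicate, smul_eq_mul, mul_one]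
    rw [show Multiset.card s = k + 1 from hs]
    ring
  · rintro _ ⟨s, _, rfl⟩ ⟨t, _, ht⟩
    have : 0 ∈ Multiset.map (· + 1) t := by rw [ht]; exact Multiset.mem_cons_self _ _
    simp at this

theorem hasGenFun_partsLE_succ {k : ℕ} {φ ψ : ℤ⟦X⟧}
    (h : HasGenFun (partsLE k) (fun s => 4 * s.sum) φ)
    (h' : HasGenFun (partsLE (k + 1)) (fun s => 4 * s.sum) ψ) :
    ψ = φ + (X ^ 4) ^ (k + 1) * ψ := by
  have e : partsLE (k + 1) = partsLE k ∪ Multiset.cons (k + 1) '' partsLE (k + 1) := by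
    ext s
    constructor
    · intro hs
      by_cases h0 : k + 1 ∈ s
      · obtain ⟨t, rfl⟩ := Multiset.exists_cons_of_mem h0
        exact Or.inr ⟨t, fun x hx => hs x (Multiset.mem_cons_of_mem hx), rfl⟩
      · refine Or.inl fun x hx => ?_
        have := hs x hx
        have : x ≠ k + 1 := fun h => h0 (h ▸ hx)
        omega
    · rintro (ht | ⟨t, ht, rfl⟩) x hx
      · have := ht x hx
        omega
      · rcases Multiset.mem_cons.1 hx with rfl | hx
        · omega
        · exact ht x hx
  refine h'.unique ?_
  rw [← pow_mul]
  nth_rewrite 1 [e]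
  refine h.union ?_ (Set.disjoint_left.2 ?_)
  · refine h'.image (fun s _ t _ hst => Multiset.cons_inj_right _ |>.1 hst) fun s hs => ?_
    rw [Multiset.sum_cons]
    ring
  · rintro _ hs ⟨t, _, rfl⟩
    have := hs (k + 1) (Multiset.mem_cons_self _ _)
    omega

theorem exists_common_genFun : ∃ a : ℕ → ℤ⟦X⟧, a 0 = 1 ∧
    (∀ k, a (k + 1) = a k + (X ^ 4) ^ (k + 1) * a (k + 1)) ∧
    (∀ k, HasGenFun (cardEq k) (fun s => 4 * s.sum) (a k)) ∧
    ∀ k, HasGenFun (partsLE k) (fun s => 4 * s.sum) (a k) := by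
  choose a ha using fun k => exists_hasGenFun (finite_fiber_cardEq k)
  choose b hb using fun k => exists_hasGenFun (finite_fiber_partsLE k)
  have hA0 : cardEq 0 = {0} := by ext s; simp [cardEq]
  have hB0 : partsLE 0 = {0} := by
    ext s
    refine ⟨fun hs => Multiset.eq_zero_of_forall_notMem fun x hx => ?_, ?_⟩
    · have := hs x hx
      omega
    · rintro rfl x hx
      simp at hx
  have ha0 : a 0 = 1 := (ha 0).unique (hA0 ▸ HasGenFun.singleton rfl)
  have hb0 : b 0 = 1 := (hb 0).unique (hB0 ▸ HasGenFun.singleton rfl)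
  have haS := fun k => hasGenFun_cardEq_succ (ha k) (ha (k + 1))
  have hbS := fun k => hasGenFun_partsLE_succ (hb k) (hb (k + 1))
  have hab : ∀ k, a k = b k := by
    intro k
    induction k with
    | zero => rw [ha0, hb0]
    | succ k ih =>
      have hne : (1 - (X ^ 4) ^ (k + 1) : ℤ⟦X⟧) ≠ 0 := by
        intro h
        simpa using congrArg constantCoeff h
      refine mul_left_cancel₀ hne ?_
      linear_combination haS k - hbS k + ih
  exact ⟨a, ha0, haS, ha, fun k => hab k ▸ hb k⟩

end Multisets

section Decompositions

open PowerSeries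

/-- The multiset in which every `2 * x + c`, for `x ∈ s`, is listed twice. -/
def doubled (c : ℕ) (s : Multiset ℕ) : Multiset ℕ := 2 • s.map (fun x => 2 * x + c)

theorem mem_doubled {c x : ℕ} {s : Multiset ℕ} : x ∈ doubled c s ↔ ∃ y ∈ s, 2 * y + c = x := by
  simp [doubled, Multiset.mem_nsmul]

theorem card_doubled (c : ℕ) (s : Multiset ℕ) :
    Multiset.card (doubled c s) = 2 * Multiset.card s := by
  simp [doubled]

theorem sum_doubled (c : ℕ) (s : Multiset ℕ) :
    (doubled c s).sum = 4 * s.sum + 2 * c * Multiset.card s := by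
  rw [doubled, Multiset.sum_nsmul, Multiset.sum_map_add,
    Multiset.sum_map_mul_left (f := fun x => x), Multiset.map_id', Multiset.map_const',
    Multiset.sum_replicate, smul_eq_mul, smul_eq_mul]
  ring

theorem even_count_doubled (c x : ℕ) (s : Multiset ℕ) : Even ((doubled c s).count x) := by
  simp [doubled, Multiset.count_nsmul]

theorem doubled_injective (c : ℕ) : Function.Injective (doubled c) := by
  intro s t h
  have h' : s.map (fun x => 2 * x + c) = t.map (fun x => 2 * x + c) := by
    ext x
    have := congrArg (Multiset.count x) h
    simp only [doubled, Multiset.count_nsmul] at this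
    omega
  exact Multiset.map_injective (fun x y hxy => by omega) h'

theorem exists_doubled {c : ℕ} {m : Multiset ℕ} (hm : ∀ x ∈ m, Even (m.count x))
    (hc : ∀ x ∈ m, ∃ y, 2 * y + c = x) : ∃ s, doubled c s = m := by
  obtain ⟨u, rfl⟩ := Multiset.exists_smul_of_dvd_count m (k := 2) fun x hx => (hm x hx).two_dvd
  refine ⟨u.map fun x => (x - c) / 2, ?_⟩
  rw [doubled, Multiset.map_map]
  congr 1
  conv_rhs => rw [← Multiset.map_id u]
  refine Multiset.map_congr rfl fun x hx => ?_
  obtain ⟨y, rfl⟩ := hc x (Multiset.mem_nsmul.2 ⟨two_ne_zero, hx⟩)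
  simp only [id, Function.comp]
  omega

theorem OStar_eq_image (k : ℕ) : {m | OStar k m} = doubled 1 '' cardEq k := by
  ext m
  constructor
  · rintro ⟨-, hodd, hcard, hcount⟩
    obtain ⟨s, rfl⟩ := exists_doubled (c := 1) (fun x _ => hcount x)
      fun x hx => (hodd x hx).imp fun _ h => h.symm
    refine ⟨s, ?_, rfl⟩
    rw [card_doubled] at hcard
    exact Nat.eq_of_mul_eq_mul_left two_pos hcard
  · rintro ⟨s, hs, rfl⟩
    refine ⟨fun x hx => ?_, fun x hx => ?_, ?_, fun x => even_count_doubled _ _ _⟩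
    · obtain ⟨y, -, rfl⟩ := mem_doubled.1 hx
      omega
    · obtain ⟨y, -, rfl⟩ := mem_doubled.1 hx
      exact odd_two_mul_add_one y
    · rw [card_doubled, show Multiset.card s = k from hs]

theorem EStar_eq_image : {m | EStar m} = doubled 0 '' {s | IsPartition s} := by
  ext m
  constructor
  · rintro ⟨hpos, heven, hcount⟩
    obtain ⟨s, rfl⟩ := exists_doubled (c := 0) (fun x _ => hcount x) fun x hx => by
      obtain ⟨y, rfl⟩ := heven x hx
      exact ⟨y, by ring⟩
    refine ⟨s, fun y hy => ?_, rfl⟩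
    have := hpos _ (mem_doubled.2 ⟨y, hy, rfl⟩)
    omega
  · rintro ⟨s, hs, rfl⟩
    refine ⟨fun x hx => ?_, fun x hx => ?_, fun x => even_count_doubled _ _ _⟩
    · obtain ⟨y, hy, rfl⟩ := mem_doubled.1 hx
      have := hs y hy
      omega
    · obtain ⟨y, -, rfl⟩ := mem_doubled.1 hx
      exact even_two_mul y

theorem multiset_sup_eq_zero_or_mem (s : Multiset ℕ) : s.sup = 0 ∨ s.sup ∈ s := by
  induction s using Multiset.induction with
  | empty => simp
  | cons a s ih =>
    rw [Multiset.sup_cons]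
    rcases le_total a s.sup with h | h
    · rw [sup_eq_right.2 h]
      exact ih.imp id Multiset.mem_cons_of_mem
    · rw [sup_eq_left.2 h]
      exact Or.inr (Multiset.mem_cons_self _ _)

theorem lep_eq_zero_or_mem (m : Multiset ℕ) : lep m = 0 ∨ lep m ∈ m :=
  (multiset_sup_eq_zero_or_mem _).imp id Multiset.mem_of_mem_filter

theorem even_lep (m : Multiset ℕ) : Even (lep m) := by
  rcases multiset_sup_eq_zero_or_mem (m.filter fun x => Even x) with h | h
  · rw [lep, h]
    exact Even.zero
  · exact Multiset.of_mem_filter h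

theorem le_lep {m : Multiset ℕ} {x : ℕ} (hx : x ∈ m) (he : Even x) : x ≤ lep m :=
  Multiset.le_sup (Multiset.mem_filter.2 ⟨hx, he⟩)

/-- The one-part partition of `2 * N`, empty when `N = 0`. -/
def evenPart (N : ℕ) : Multiset ℕ := if N = 0 then 0 else {2 * N}

theorem mem_evenPart {N x : ℕ} : x ∈ evenPart N ↔ N ≠ 0 ∧ x = 2 * N := by
  unfold evenPart
  split_ifs with h <;> simp [h]

theorem sum_evenPart (N : ℕ) : (evenPart N).sum = 2 * N := by
  unfold evenPart
  split_ifs with h <;> simp [h]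

/-- The element of `EO*` with largest even part `2 * N` encoded by its odd parts and by its even
parts other than one copy of the largest. -/
def joinEvenOdd (N : ℕ) (p : Multiset ℕ × Multiset ℕ) : Multiset ℕ :=
  doubled (2 * N + 1) p.1 + (doubled 0 p.2 + evenPart N)

theorem even_of_mem_doubled_add_evenPart {N x : ℕ} {v : Multiset ℕ}
    (hx : x ∈ doubled 0 v + evenPart N) : Even x := by
  rcases Multiset.mem_add.1 hx with hx | hx
  · obtain ⟨y, -, rfl⟩ := mem_doubled.1 hx
    exact even_two_mul y
  · rw [(mem_evenPart.1 hx).2]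
    exact even_two_mul N

theorem odd_of_mem_doubled {N x : ℕ} {s : Multiset ℕ} (hx : x ∈ doubled (2 * N + 1) s) :
    Odd x := by
  obtain ⟨y, -, rfl⟩ := mem_doubled.1 hx
  exact ⟨y + N, by ring⟩

theorem filter_odd_joinEvenOdd (N : ℕ) (p : Multiset ℕ × Multiset ℕ) :
    (joinEvenOdd N p).filter (fun x => Odd x) = doubled (2 * N + 1) p.1 := by
  rw [joinEvenOdd, Multiset.filter_add, Multiset.filter_eq_self.2 fun x => odd_of_mem_doubled,
    Multiset.filter_eq_nil.2, add_zero]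
  exact fun x hx => Nat.not_odd_iff_even.2 (even_of_mem_doubled_add_evenPart hx)

theorem filter_even_joinEvenOdd (N : ℕ) (p : Multiset ℕ × Multiset ℕ) :
    (joinEvenOdd N p).filter (fun x => Even x) = doubled 0 p.2 + evenPart N := by
  rw [joinEvenOdd, Multiset.filter_add,
    Multiset.filter_eq_self.2 fun x => even_of_mem_doubled_add_evenPart,
    Multiset.filter_eq_nil.2, zero_add]
  exact fun x hx => Nat.not_even_iff_odd.2 (odd_of_mem_doubled hx)

theorem joinEvenOdd_injective (N : ℕ) : Function.Injective (joinEvenOdd N) := by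
  intro p q h
  have h1 := congrArg (Multiset.filter fun x => Odd x) h
  have h2 := congrArg (Multiset.filter fun x => Even x) h
  rw [filter_odd_joinEvenOdd, filter_odd_joinEvenOdd] at h1
  rw [filter_even_joinEvenOdd, filter_even_joinEvenOdd] at h2
  exact Prod.ext (doubled_injective _ h1) (doubled_injective _ (add_left_injective _ h2))

theorem lep_joinEvenOdd {N : ℕ} {p : Multiset ℕ × Multiset ℕ} (hp : p.2 ∈ partsLE N) :
    lep (joinEvenOdd N p) = 2 * N := by
  rw [lep, filter_even_joinEvenOdd]
  refine le_antisymm (Multiset.sup_le.2 fun x hx => ?_) ?_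
  · rcases Multiset.mem_add.1 hx with hx | hx
    · obtain ⟨y, hy, rfl⟩ := mem_doubled.1 hx
      have := hp y hy
      omega
    · exact (mem_evenPart.1 hx).2.le
  · rcases Nat.eq_zero_or_pos N with rfl | hN
    · simp
    · exact Multiset.le_sup (Multiset.mem_add.2 (Or.inr (mem_evenPart.2 ⟨hN.ne', rfl⟩)))

theorem EOStar_joinEvenOdd {N : ℕ} {p : Multiset ℕ × Multiset ℕ} (hp : p.2 ∈ partsLE N) :
    EOStar (joinEvenOdd N p) := by
  have hpos : IsPartition (joinEvenOdd N p) := by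
    intro x hx
    rcases Multiset.mem_add.1 hx with hx | hx
    · exact (odd_of_mem_doubled hx).pos
    rcases Multiset.mem_add.1 hx with hx | hx
    · obtain ⟨y, hy, rfl⟩ := mem_doubled.1 hx
      have := hp y hy
      omega
    · have := mem_evenPart.1 hx
      omega
  have hcount : ∀ x, (joinEvenOdd N p).count x = (doubled (2 * N + 1) p.1).count x +
      ((doubled 0 p.2).count x + (evenPart N).count x) := fun x => by
    rw [joinEvenOdd, Multiset.count_add, Multiset.count_add]
  refine ⟨hpos, fun x hx y hy hxe hyo => ?_, fun x hx hne => ?_, fun x hx he => ?_⟩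
  · have h1 := le_lep hx hxe
    rw [lep_joinEvenOdd hp] at h1
    have h2 : y ∈ (joinEvenOdd N p).filter fun x => Odd x := Multiset.mem_filter.2 ⟨hy, hyo⟩
    rw [filter_odd_joinEvenOdd] at h2
    obtain ⟨z, -, rfl⟩ := mem_doubled.1 h2
    omega
  · rw [lep_joinEvenOdd hp] at hne
    rw [hcount, Multiset.count_eq_zero_of_notMem fun h => hne (mem_evenPart.1 h).2, add_zero]
    exact (even_count_doubled _ _ _).add (even_count_doubled _ _ _)
  · rw [lep_joinEvenOdd hp] at he
    have hN : N ≠ 0 := by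
      have := hpos x hx
      omega
    have h1 : (evenPart N).count x = 1 := by simp [evenPart, hN, he]
    rw [hcount, h1]
    exact (even_count_doubled _ _ _).add_odd ((even_count_doubled _ _ _).add_odd odd_one)

theorem exists_doubled_filter_odd {m : Multiset ℕ} (hm : EOStar m) :
    ∃ s, doubled (lep m + 1) s = m.filter fun x => Odd x := by
  refine exists_doubled (fun x hx => ?_) fun x hx => ?_
  · obtain ⟨hxm, hodd⟩ := Multiset.mem_filter.1 hx
    rw [Multiset.count_filter_of_pos hodd]
    exact hm.2.2.1 x hxm fun h => Nat.not_even_iff_odd.2 hodd (h ▸ even_lep m)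
  · obtain ⟨hxm, hodd⟩ := Multiset.mem_filter.1 hx
    obtain ⟨N, hN⟩ := even_lep m
    obtain ⟨y, rfl⟩ := hodd
    have hlt : lep m < 2 * y + 1 := by
      rcases lep_eq_zero_or_mem m with h | h
      · omega
      · exact hm.2.1 _ h _ hxm (even_lep m) (odd_two_mul_add_one y)
    exact ⟨y - N, by omega⟩

theorem exists_joinEvenOdd {m : Multiset ℕ} {N : ℕ} (hm : EOStar m) (hN : lep m = 2 * N) :
    ∃ p, p.2 ∈ partsLE N ∧ joinEvenOdd N p = m := by
  obtain ⟨s, hs⟩ := exists_doubled_filter_odd hm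
  rw [hN] at hs
  suffices H : ∃ v ∈ partsLE N, doubled 0 v + evenPart N = m.filter fun x => Even x by
    obtain ⟨v, hv, hve⟩ := H
    refine ⟨(s, v), hv, ?_⟩
    rw [joinEvenOdd, hs, hve, add_comm]
    simp_rw [← Nat.not_even_iff_odd]
    exact Multiset.filter_add_not _ _
  have hle : evenPart N ≤ m.filter fun x => Even x := by
    unfold evenPart
    split_ifs with h
    · exact Multiset.zero_le _
    · rw [Multiset.singleton_le]
      have := (lep_eq_zero_or_mem m).resolve_left (by omega)
      exact Multiset.mem_filter.2 ⟨hN ▸ this, even_two_mul N⟩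
  obtain ⟨E, hE⟩ := Multiset.le_iff_exists_add.1 hle
  have hmem : ∀ x ∈ E, x ∈ m ∧ Even x := fun x hx =>
    Multiset.mem_filter.1 (hE ▸ Multiset.mem_add.2 (Or.inr hx))
  have hcount : ∀ x ∈ E, Even (E.count x) := by
    intro x hx
    obtain ⟨hxm, hxe⟩ := hmem x hx
    have h1 := congrArg (Multiset.count x) hE
    rw [Multiset.count_filter_of_pos hxe, Multiset.count_add] at h1
    by_cases h : x = lep m
    · have h2 := hm.2.2.2 x hxm h
      have hN0 : N ≠ 0 := by
        have := hm.1 x hxm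
        omega
      have h3 : (evenPart N).count x = 1 := by simp [evenPart, hN0, h, hN]
      rw [h1, h3, add_comm, Nat.odd_add_one, Nat.not_odd_iff_even] at h2
      exact h2
    · have h2 := hm.2.2.1 x hxm h
      rw [h1, Multiset.count_eq_zero_of_notMem fun h' => h (hN ▸ (mem_evenPart.1 h').2),
        zero_add] at h2
      exact h2
  obtain ⟨v, rfl⟩ := exists_doubled (c := 0) hcount fun x hx => by
    obtain ⟨y, rfl⟩ := (hmem x hx).2
    exact ⟨y, by ring⟩
  refine ⟨v, fun y hy => ?_, by rw [hE, add_comm]⟩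
  obtain ⟨h1, h2⟩ := hmem (2 * y + 0) (mem_doubled.2 ⟨y, hy, rfl⟩)
  have := hm.1 _ h1
  have := le_lep h1 h2
  omega

theorem EOkr_eq_image (k r : ℕ) :
    {m | EOkr k r m} = joinEvenOdd (k + r) '' (cardEq k ×ˢ partsLE (k + r)) := by
  ext m
  constructor
  · rintro ⟨hm, hodd, hlep⟩
    obtain ⟨p, hp, rfl⟩ := exists_joinEvenOdd (N := k + r) hm (by omega)
    rw [filter_odd_joinEvenOdd, card_doubled] at hodd
    exact ⟨p, ⟨Nat.eq_of_mul_eq_mul_left two_pos hodd, hp⟩, rfl⟩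
  · rintro ⟨p, ⟨hs, hp⟩, rfl⟩
    refine ⟨EOStar_joinEvenOdd hp, ?_, ?_⟩
    · rw [filter_odd_joinEvenOdd, card_doubled, show Multiset.card p.1 = k from hs]
    · rw [lep_joinEvenOdd hp]
      ring

theorem EOStar_and_eoc_eq_iff (r : ℕ) (m : Multiset ℕ) :
    EOStar m ∧ eoc m = 2 * (r : ℤ) ↔ ∃ k, EOkr k r m := by
  constructor
  · rintro ⟨hm, hr⟩
    obtain ⟨s, hs⟩ := exists_doubled_filter_odd hm
    have hc := congrArg Multiset.card hs
    rw [card_doubled] at hc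
    rw [eoc, ← hc] at hr
    push_cast at hr
    exact ⟨Multiset.card s, hm, hc.symm, by omega⟩
  · rintro ⟨k, hm, hodd, hlep⟩
    refine ⟨hm, ?_⟩
    rw [eoc, hodd, hlep]
    push_cast
    ring

end Decompositions

section MainTheorem

open PowerSeries

theorem hasGenFun_OStar {k : ℕ} {φ : ℤ⟦X⟧} (h : HasGenFun (cardEq k) (fun s => 4 * s.sum) φ) :
    HasGenFun {m | OStar k m} Multiset.sum (X ^ (2 * k) * φ) := by
  rw [OStar_eq_image]
  refine h.image (doubled_injective 1).injOn fun s hs => ?_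
  rw [sum_doubled, show Multiset.card s = k from hs, mul_one]

theorem hasGenFun_EOkr {k r : ℕ} {φ ψ : ℤ⟦X⟧}
    (h : HasGenFun (cardEq k) (fun s => 4 * s.sum) φ)
    (h' : HasGenFun (partsLE (k + r)) (fun s => 4 * s.sum) ψ) :
    HasGenFun {m | EOkr k r m} Multiset.sum (X ^ (4 * (k * (k + r + 1)) + 2 * r) * (φ * ψ)) := by
  rw [EOkr_eq_image]
  refine (h.prod h').image (joinEvenOdd_injective _).injOn fun p hp => ?_
  rw [joinEvenOdd, Multiset.sum_add, Multiset.sum_add, sum_doubled, sum_doubled, sum_evenPart,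
    show Multiset.card p.1 = k from hp.1]
  ring

theorem exists_hasGenFun_EStar : ∃ P, HasGenFun {m | EStar m} Multiset.sum P ∧
    ∀ K φ, HasGenFun (partsLE K) (fun s => 4 * s.sum) φ → (X ^ 4) ^ K ∣ P - φ := by
  obtain ⟨P, hP⟩ := exists_hasGenFun (S := {s | IsPartition s}) (w := fun s => 4 * s.sum)
    fun n => (finite_card_le_sum_eq (n / 4) (n / 4)).subset fun s hs => by
      have h1 := IsPartition.card_le_sum hs.1
      have h2 : 4 * s.sum = n := hs.2
      exact ⟨by omega, by omega⟩
  refine ⟨P, ?_, fun K φ hφ => ?_⟩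
  · rw [EStar_eq_image]
    simpa using hP.image (j := 0) (w' := Multiset.sum) (doubled_injective 0).injOn
      fun s _ => by simp [sum_doubled]
  · rw [← pow_mul, X_pow_dvd_iff]
    intro m hm
    rw [map_sub, (hP m).2, (hφ m).2, sub_eq_zero]
    congr 2
    ext s
    refine ⟨fun ⟨hs, hsum⟩ => ⟨fun x hx => ?_, hsum⟩, fun ⟨hs, hsum⟩ => ⟨fun x hx => ?_, hsum⟩⟩
    · have h1 := Multiset.le_sum_of_mem hx
      have h2 : 0 < x := hs x hx
      have h3 : 4 * s.sum = m := hsum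
      exact ⟨h2, by omega⟩
    · exact (hs x hx).1

theorem genFun_congr {a : ℕ → ℤ⟦X⟧} {P : ℤ⟦X⟧} {K : ℕ} (ha0 : a 0 = 1)
    (ha : ∀ k, a (k + 1) = a k + (X ^ 4) ^ (k + 1) * a (k + 1))
    (hP : (X ^ 4) ^ K ∣ P - a K) (r : ℕ) :
    (X ^ 4) ^ K ∣
      ∑ k ∈ Finset.range (K + 1), X ^ (2 * k) * a k * (X ^ (2 * (k + r)) * a (k + r)) -
      P * ∑ k ∈ Finset.range (K + 1),
        X ^ (4 * (k * (k + r + 1)) + 2 * r) * (a k * a (k + r)) := by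
  have e1 : ∑ k ∈ Finset.range (K + 1), X ^ (2 * k) * a k * (X ^ (2 * (k + r)) * a (k + r)) =
      X ^ (2 * r) * ∑ k ∈ Finset.range (K + 1), (X ^ 4) ^ k * a k * a (k + r) := by
    rw [Finset.mul_sum]
    exact Finset.sum_congr rfl fun k _ => by ring
  have e2 : ∑ k ∈ Finset.range (K + 1),
        X ^ (4 * (k * (k + r + 1)) + 2 * r) * (a k * a (k + r)) =
      X ^ (2 * r) * ∑ k ∈ Finset.range (K + 1),
        (X ^ 4) ^ (k * (k + r + 1)) * a k * a (k + r) := by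
    rw [Finset.mul_sum]
    refine Finset.sum_congr rfl fun k _ => ?_
    rw [← pow_mul, pow_add]
    ring
  let I : Ideal ℤ⟦X⟧ := Ideal.span {(X ^ 4) ^ K}
  let π := Ideal.Quotient.mk I
  rw [← Ideal.mem_span_singleton, ← Ideal.Quotient.eq] at hP ⊢
  have hQ : π (X ^ 4) ^ K = 0 := by
    rw [← map_pow]
    exact Ideal.Quotient.eq_zero_iff_mem.2 (Ideal.mem_span_singleton_self _)
  have key := sum_mul_eq_mul_durfee_sum (a := fun k => π (a k)) hQ (by simp [ha0])
    (fun k => by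
      have := congrArg π (ha k)
      rwa [map_add, map_mul, map_pow] at this) r
  rw [e1, e2, map_mul, map_mul, map_mul, map_sum, map_sum, hP]
  simp only [map_mul, map_pow] at key ⊢
  rw [key]
  ring

theorem OStar.le_sum {k : ℕ} {m : Multiset ℕ} (h : OStar k m) : k ≤ m.sum := by
  have h1 := IsPartition.card_le_sum h.1
  have h2 := h.2.2.1
  omega

theorem EOkr.le_sum {k r : ℕ} {m : Multiset ℕ} (h : EOkr k r m) : k ≤ m.sum := by
  have h1 := IsPartition.card_le_sum h.1.1
  have h2 := Multiset.card_le_card (Multiset.filter_le (fun x => Odd x) m)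
  have h3 := h.2.1
  omega

end MainTheorem


/-- For all nonnegative integers `r` and `n`, the number of pairs
`(λ*, π*) ∈ O_k* × O_{k+r}*` for some `k` with `|λ*| + |π*| = n` equals the number of pairs
`(μ*, ν*)` with `μ* ∈ E*`, `ν* ∈ EO*` with even-odd crank `2r`, and `|μ*| + |ν*| = n`. -/
theorem stmt3 (r n : ℕ) :
    {p : Multiset ℕ × Multiset ℕ |
      (∃ k : ℕ, OStar k p.1 ∧ OStar (k + r) p.2) ∧ p.1.sum + p.2.sum = n}.ncard =
    {p : Multiset ℕ × Multiset ℕ |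
      EStar p.1 ∧ EOStar p.2 ∧ eoc p.2 = 2 * (r : ℤ) ∧
      p.1.sum + p.2.sum = n}.ncard := by
  obtain ⟨a, ha0, ha, hA, hB⟩ := exists_common_genFun
  obtain ⟨P, hP, hPa⟩ := exists_hasGenFun_EStar
  have hL := (HasGenFun.biUnion_lt (fun k => (hasGenFun_OStar (hA k)).prod
    (hasGenFun_OStar (hA (k + r)))) (fun i j p hi hj => by
      have h1 : Multiset.card p.1 = 2 * i := hi.1.2.2.1
      have h2 : Multiset.card p.1 = 2 * j := hj.1.2.2.1
      omega) (n + 1 + 1) n).2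
  have hR := (hP.prod (HasGenFun.biUnion_lt (fun k => hasGenFun_EOkr (hA k) (hB (k + r)))
    (fun i j m hi hj => by
      have h1 := hi.2.1
      have h2 := hj.2.1
      omega) (n + 1 + 1)) n).2
  have hdvd := genFun_congr ha0 ha (hPa (n + 1) _ (hB (n + 1))) r
  rw [← pow_mul, PowerSeries.X_pow_dvd_iff] at hdvd
  have hcoeff := hdvd n (by omega)
  rw [map_sub, sub_eq_zero, hL, hR, Nat.cast_inj] at hcoeff
  convert hcoeff using 2
  · ext p
    constructor
    · rintro ⟨⟨k, h1, h2⟩, hn⟩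
      have := h1.le_sum
      exact ⟨⟨k, by omega, h1, h2⟩, hn⟩
    · rintro ⟨⟨k, -, h1, h2⟩, hn⟩
      exact ⟨⟨k, h1, h2⟩, hn⟩
  · ext p
    constructor
    · rintro ⟨h1, h2, hr, hn⟩
      obtain ⟨k, hk⟩ := (EOStar_and_eoc_eq_iff r p.2).1 ⟨h2, hr⟩
      have := hk.le_sum
      exact ⟨⟨h1, k, by omega, hk⟩, hn⟩
    · rintro ⟨⟨h1, k, -, hk⟩, hn⟩
      obtain ⟨h2, hr⟩ := (EOStar_and_eoc_eq_iff r p.2).2 ⟨k, hk⟩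
      exact ⟨h1, h2, hr, hn⟩
end

section
/- For every positive integer n and every integer c, the number of pairs (μ, ν) with μ ∈ E*, ν ∈ EO*, eoc(ν) = c, and |μ| + |ν| = n equals the number of pairs (λ, π) of partitions into parts congruent to 2 modulo 4 with |λ| + |π| = n and 2·(number of parts of λ) − 2·(number of parts of π) = c. -/
open PowerSeries in
/-- The generating function of a weighted type all of whose weight fibres are finite. -/
noncomputable def weightGF {α : Type*} (f : α → ℕ) : ℤ⟦X⟧ :=
  PowerSeries.mk fun n => (Nat.card {x // f x = n} : ℤ)

/-- Every weight is attained only finitely often. -/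
def FiniteFibers {α : Type*} (f : α → ℕ) : Prop := ∀ n, Finite {x // f x = n}

section WeightGF

open PowerSeries

variable {α β : Type*} {f : α → ℕ} {g : β → ℕ}

lemma weightGF_congr (e : α ≃ β) (h : ∀ x, g (e x) = f x) : weightGF f = weightGF g := by
  ext n
  simp only [weightGF, coeff_mk, Nat.cast_inj]
  exact Nat.card_congr (e.subtypeEquiv fun x => by rw [h])

lemma FiniteFibers.of_injective (hg : FiniteFibers g) (e : α → β) (he : e.Injective)
    (h : ∀ x, g (e x) = f x) : FiniteFibers f := fun n => by
  have := hg n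
  exact Finite.of_injective (fun x : {x // f x = n} => (⟨e x, by rw [h, x.2]⟩ : {y // g y = n}))
    fun x y hxy => Subtype.ext (he (congrArg Subtype.val hxy))

lemma weightGF_sum (hf : FiniteFibers f) (hg : FiniteFibers g) :
    weightGF (Sum.elim f g) = weightGF f + weightGF g := by
  ext n
  have : Finite {x // Sum.elim f g (.inl x) = n} := hf n
  have : Finite {x // Sum.elim f g (.inr x) = n} := hg n
  simp only [weightGF, coeff_mk, map_add]
  rw [Nat.card_congr (Equiv.subtypeSum (p := fun x => Sum.elim f g x = n)), Nat.card_sum]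
  simp

/-- The fibre of a weight on a sigma type is the sigma type of the fibres. -/
def sigmaFiberwiseEquiv {ι : Type*} {α : ι → Type*} (f : ∀ i, α i → ℕ) (n : ℕ) :
    {x : Σ i, α i // f x.1 x.2 = n} ≃ Σ i, {x // f i x = n} where
  toFun x := ⟨x.1.1, x.1.2, x.2⟩
  invFun x := ⟨⟨x.1, x.2.1⟩, x.2.2⟩
  left_inv _ := rfl
  right_inv _ := rfl

lemma weightGF_sigma {ι : Type*} [Fintype ι] {α : ι → Type*} {f : ∀ i, α i → ℕ}
    (hf : ∀ i, FiniteFibers (f i)) :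
    weightGF (fun x : Σ i, α i => f x.1 x.2) = ∑ i, weightGF (f i) := by
  ext n
  have := fun i => hf i n
  simp only [weightGF, coeff_mk, map_sum]
  rw [Nat.card_congr (sigmaFiberwiseEquiv f n), Nat.card_sigma]
  simp

lemma weightGF_add_const (k : ℕ) :
    weightGF (fun x => f x + k) = X ^ k * weightGF f := by
  ext n
  rw [coeff_X_pow_mul']
  simp only [weightGF, coeff_mk]
  split_ifs with h
  · rw [Nat.card_congr (Equiv.subtypeEquivRight (q := fun x => f x = n - k)
      fun x => by omega)]
  · have : IsEmpty {x // f x + k = n} := ⟨fun x => by have := x.2; omega⟩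
    simp

/-- The fibre of a sum of two weights is a union of products of fibres. -/
def prodFiberEquiv (f : α → ℕ) (g : β → ℕ) (n : ℕ) :
    {p : α × β // f p.1 + g p.2 = n} ≃
      Σ ij : Finset.HasAntidiagonal.antidiagonal n, {x // f x = ij.1.1} × {y // g y = ij.1.2} where
  toFun p := ⟨⟨(f p.1.1, g p.1.2), by simpa using p.2⟩, ⟨p.1.1, rfl⟩, ⟨p.1.2, rfl⟩⟩
  invFun q := ⟨(q.2.1.1, q.2.2.1), by
    rw [q.2.1.2, q.2.2.2]; exact Finset.HasAntidiagonal.mem_antidiagonal.1 q.1.2⟩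
  left_inv _ := rfl
  right_inv := by
    rintro ⟨⟨⟨i, j⟩, h⟩, ⟨x, hx⟩, ⟨y, hy⟩⟩
    dsimp only at hx hy
    subst hx hy
    rfl

lemma FiniteFibers.prod (hf : FiniteFibers f) (hg : FiniteFibers g) :
    FiniteFibers (fun p : α × β => f p.1 + g p.2) := fun n => by
  have := fun n => hf n
  have := fun n => hg n
  exact Finite.of_equiv _ (prodFiberEquiv f g n).symm

lemma FiniteFibers.add_const (hf : FiniteFibers f) (k : ℕ) :
    FiniteFibers fun x => f x + k :=
  (hf.prod (β := Unit) (g := fun _ => k) fun _ => inferInstance).of_injective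
    (fun x => (x, ())) (fun _ _ h => by simpa using h) (fun _ => rfl)

lemma weightGF_prod (hf : FiniteFibers f) (hg : FiniteFibers g) :
    weightGF (fun p : α × β => f p.1 + g p.2) = weightGF f * weightGF g := by
  ext n
  have := fun n => hf n
  have := fun n => hg n
  rw [coeff_mul]
  simp only [weightGF, coeff_mk]
  rw [Nat.card_congr (prodFiberEquiv f g n), Nat.card_sigma]
  simp only [Nat.card_prod, Nat.cast_sum, Nat.cast_mul]
  exact Finset.sum_coe_sort (Finset.HasAntidiagonal.antidiagonal n)
    fun ij => (Nat.card {x // f x = ij.1} : ℤ) * (Nat.card {y // g y = ij.2} : ℤ)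

end WeightGF

section Counting

open PowerSeries

lemma finite_multiset_of_bounded (k n : ℕ) :
    {m : Multiset ℕ | m.card ≤ k ∧ ∀ x ∈ m, x ≤ n}.Finite := by
  refine (Set.finite_Iic (k • Multiset.range (n + 1))).subset ?_
  rintro m ⟨hk, hn⟩
  rw [Set.mem_Iic, Multiset.le_iff_count]
  intro x
  by_cases hx : x ∈ m
  · have h1 : Multiset.count x (Multiset.range (n + 1)) = 1 :=
      Multiset.count_eq_one_of_mem (Multiset.nodup_range _)
        (by have := hn x hx; simp; omega)
    rw [Multiset.count_nsmul, h1, mul_one]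
    exact (Multiset.count_le_card x m).trans hk
  · simp [Multiset.count_eq_zero_of_notMem hx]

/-- The generating function of multisets of `k` natural numbers. -/
noncomputable def cardGF (k : ℕ) : ℤ⟦X⟧ :=
  weightGF fun m : {m : Multiset ℕ // m.card = k} => m.1.sum

/-- The generating function of partitions into parts at most `k`. -/
noncomputable def boundedGF (k : ℕ) : ℤ⟦X⟧ :=
  weightGF fun m : {m : Multiset ℕ // ∀ x ∈ m, 0 < x ∧ x ≤ k} => m.1.sum

lemma finiteFibers_card (k : ℕ) :
    FiniteFibers fun m : {m : Multiset ℕ // m.card = k} => m.1.sum := fun n => by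
  have := (finite_multiset_of_bounded k n).to_subtype
  refine Finite.of_injective (β := {m : Multiset ℕ | m.card ≤ k ∧ ∀ x ∈ m, x ≤ n})
    (fun m => ⟨m.1.1, m.1.2.le, fun x hx => m.2 ▸ Multiset.le_sum_of_mem hx⟩) ?_
  intro a b h
  simpa [Subtype.ext_iff] using h

lemma card_le_sum_of_pos {m : Multiset ℕ} (h : ∀ x ∈ m, 0 < x) : m.card ≤ m.sum := by
  have := Multiset.card_nsmul_le_sum (s := m) (a := 1) fun x hx => h x hx
  simpa using this

lemma finiteFibers_bounded (k : ℕ) :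
    FiniteFibers fun m : {m : Multiset ℕ // ∀ x ∈ m, 0 < x ∧ x ≤ k} => m.1.sum := fun n => by
  have := (finite_multiset_of_bounded n n).to_subtype
  refine Finite.of_injective (β := {m : Multiset ℕ | m.card ≤ n ∧ ∀ x ∈ m, x ≤ n})
    (fun m => ⟨m.1.1, (card_le_sum_of_pos fun x hx => (m.1.2 x hx).1).trans m.2.le,
      fun x hx => m.2 ▸ Multiset.le_sum_of_mem hx⟩) ?_
  intro a b h
  simpa [Subtype.ext_iff] using h

lemma cardGF_zero : cardGF 0 = 1 := by
  ext n
  rw [cardGF, weightGF, coeff_mk, coeff_one]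
  split_ifs with h
  · subst h
    have : Unique {x : {m : Multiset ℕ // m.card = 0} // x.1.sum = 0} :=
      ⟨⟨⟨⟨0, by simp⟩, by simp⟩⟩, fun a =>
        Subtype.ext (Subtype.ext (Multiset.card_eq_zero.1 a.1.2))⟩
    simp
  · have : IsEmpty {x : {m : Multiset ℕ // m.card = 0} // x.1.sum = n} :=
      ⟨fun a => by
        have h1 := a.1.2
        have h2 := a.2
        rw [Multiset.card_eq_zero] at h1
        rw [h1] at h2
        exact h h2.symm⟩
    simp

lemma boundedGF_zero : boundedGF 0 = 1 := by
  rw [← cardGF_zero]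
  refine weightGF_congr (Equiv.subtypeEquivRight fun m => ?_) fun x => rfl
  rw [Multiset.card_eq_zero]
  refine ⟨fun h => Multiset.eq_zero_of_forall_notMem fun x hx => ?_, fun h => by simp [h]⟩
  have := h x hx
  omega

lemma cardGF_succ (k : ℕ) : cardGF k = (1 - X ^ (k + 1)) * cardGF (k + 1) := by
  suffices cardGF (k + 1) = cardGF k + X ^ (k + 1) * cardGF (k + 1) by
    linear_combination -this
  unfold cardGF
  rw [← weightGF_add_const, ← weightGF_sum (finiteFibers_card k)]
  · symm
    let e : {m : Multiset ℕ // m.card = k} ⊕ {m : Multiset ℕ // m.card = k + 1} →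
        {m : Multiset ℕ // m.card = k + 1} :=
      Sum.elim (fun m => ⟨0 ::ₘ m.1, by simp [m.2]⟩)
        (fun m => ⟨m.1.map (· + 1), by simp [m.2]⟩)
    have he : e.Bijective := by
      constructor
      · rintro (⟨a, ha⟩ | ⟨a, ha⟩) (⟨b, hb⟩ | ⟨b, hb⟩) h
        · simpa [e] using h
        · have h' : 0 ::ₘ a = b.map (· + 1) := Subtype.ext_iff.1 h
          have h0 : 0 ∈ b.map (· + 1) := by simp [← h', -Multiset.mem_map]
          simp at h0
        · have h' : a.map (· + 1) = 0 ::ₘ b := Subtype.ext_iff.1 h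
          have h0 : 0 ∈ a.map (· + 1) := by simp [h', -Multiset.mem_map]
          simp at h0
        · have := Multiset.map_injective (add_left_injective 1)
            (Subtype.ext_iff.1 h : a.map (· + 1) = b.map (· + 1))
          subst this; rfl
      · rintro ⟨m, hm⟩
        by_cases h0 : 0 ∈ m
        · obtain ⟨a, rfl⟩ := Multiset.exists_cons_of_mem h0
          exact ⟨Sum.inl ⟨a, by simpa using hm⟩, rfl⟩
        · refine ⟨Sum.inr ⟨m.map (· - 1), by simpa using hm⟩, Subtype.ext ?_⟩
          simp only [e, Sum.elim_inr, Multiset.map_map, Function.comp_apply]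
          conv_rhs => rw [← Multiset.map_id m]
          refine Multiset.map_congr rfl fun x hx => ?_
          have : x ≠ 0 := fun h => h0 (h ▸ hx)
          simp; omega
    refine weightGF_congr (Equiv.ofBijective e he) ?_
    rintro (⟨a, ha⟩ | ⟨a, ha⟩)
    · simp [e]
    · simp [e, Multiset.sum_map_add, ha, add_comm]
  · exact (finiteFibers_card (k + 1)).add_const _

lemma boundedGF_succ (k : ℕ) : boundedGF k = (1 - X ^ (k + 1)) * boundedGF (k + 1) := by
  suffices boundedGF (k + 1) = boundedGF k + X ^ (k + 1) * boundedGF (k + 1) by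
    linear_combination -this
  unfold boundedGF
  rw [← weightGF_add_const, ← weightGF_sum (finiteFibers_bounded k)]
  · symm
    let e : {m : Multiset ℕ // ∀ x ∈ m, 0 < x ∧ x ≤ k} ⊕
        {m : Multiset ℕ // ∀ x ∈ m, 0 < x ∧ x ≤ k + 1} →
        {m : Multiset ℕ // ∀ x ∈ m, 0 < x ∧ x ≤ k + 1} :=
      Sum.elim (fun m => ⟨m.1, fun x hx => by have := m.2 x hx; omega⟩)
        (fun m => ⟨(k + 1) ::ₘ m.1, fun x hx => by
          rcases Multiset.mem_cons.1 hx with rfl | hx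
          · omega
          · exact m.2 x hx⟩)
    have he : e.Bijective := by
      constructor
      · rintro (⟨a, ha⟩ | ⟨a, ha⟩) (⟨b, hb⟩ | ⟨b, hb⟩) h
        · simpa [e] using h
        · have h' : a = (k + 1) ::ₘ b := Subtype.ext_iff.1 h
          have := ha (k + 1) (by simp [h'])
          omega
        · have h' : (k + 1) ::ₘ a = b := Subtype.ext_iff.1 h
          have := hb (k + 1) (by simp [← h'])
          omega
        · simpa [e] using h
      · rintro ⟨m, hm⟩
        by_cases h0 : k + 1 ∈ m
        · obtain ⟨a, rfl⟩ := Multiset.exists_cons_of_mem h0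
          exact ⟨Sum.inr ⟨a, fun x hx => hm x (Multiset.mem_cons_of_mem hx)⟩, rfl⟩
        · refine ⟨Sum.inl ⟨m, fun x hx => ?_⟩, rfl⟩
          have := hm x hx
          have : x ≠ k + 1 := fun h => h0 (h ▸ hx)
          omega
    refine weightGF_congr (Equiv.ofBijective e he) ?_
    rintro (⟨a, ha⟩ | ⟨a, ha⟩)
    · simp [e]
    · simp [e, add_comm]
  · exact (finiteFibers_bounded (k + 1)).add_const _

lemma one_sub_X_pow_succ_ne_zero (k : ℕ) : (1 - X ^ (k + 1) : ℤ⟦X⟧) ≠ 0 := fun h => by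
  have := congrArg constantCoeff h
  simp at this

lemma boundedGF_eq_cardGF (k : ℕ) : boundedGF k = cardGF k := by
  induction k with
  | zero => rw [boundedGF_zero, cardGF_zero]
  | succ k ih =>
    refine mul_left_cancel₀ (one_sub_X_pow_succ_ne_zero k) ?_
    rw [← boundedGF_succ, ← cardGF_succ, ih]

/-- The generating function of multisets of `l - s` natural numbers, zero when `l < s`. -/
noncomputable def codimGF (l s : ℕ) : ℤ⟦X⟧ :=
  weightGF fun m : {m : Multiset ℕ // s + m.card = l} => m.1.sum

lemma codimGF_of_le {l s : ℕ} (h : s ≤ l) : codimGF l s = cardGF (l - s) :=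
  weightGF_congr (Equiv.subtypeEquivRight fun m => by omega) fun x => rfl

lemma codimGF_of_lt {l s : ℕ} (h : l < s) : codimGF l s = 0 := by
  have : IsEmpty {m : Multiset ℕ // s + m.card = l} := ⟨fun m => by have := m.2; omega⟩
  ext n
  simp [codimGF, weightGF]

lemma codimGF_succ (l s : ℕ) : codimGF l (s + 1) = (1 - X ^ (l - s)) * codimGF l s := by
  rcases lt_trichotomy s l with h | rfl | h
  · rw [codimGF_of_le h, codimGF_of_le h.le]
    obtain ⟨d, rfl⟩ := Nat.exists_eq_add_of_lt h
    have h1 : s + d + 1 - (s + 1) = d := by omega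
    have h2 : s + d + 1 - s = d + 1 := by omega
    rw [h1, h2, cardGF_succ]
  · simp [codimGF_of_lt]
  · rw [codimGF_of_lt h, codimGF_of_lt (by omega), mul_zero]

/-- A form of the `q`-Vandermonde identity. -/
lemma sum_durfee (M L : ℕ) :
    ∑ s ∈ Finset.range (M + 1),
      X ^ ((M - s) * (L - s)) * (cardGF s * (cardGF (M - s) * codimGF L s)) =
    cardGF M * cardGF L := by
  induction M with
  | zero => simp [codimGF_of_le, cardGF_zero]
  | succ M ih =>
    refine mul_left_cancel₀ (one_sub_X_pow_succ_ne_zero M) ?_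
    rw [← mul_assoc, ← cardGF_succ, ← ih, Finset.mul_sum]
    have key : ∀ s ∈ Finset.range (M + 1 + 1),
        (1 - X ^ (M + 1)) * (X ^ ((M + 1 - s) * (L - s)) *
          (cardGF s * (cardGF (M + 1 - s) * codimGF L s))) =
        (1 - X ^ (M + 1 - s)) * (X ^ ((M + 1 - s) * (L - s)) *
          (cardGF s * (cardGF (M + 1 - s) * codimGF L s))) +
        X ^ (M + 1 - s) * (1 - X ^ s) * (X ^ ((M + 1 - s) * (L - s)) *
          (cardGF s * (cardGF (M + 1 - s) * codimGF L s))) := by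
      intro s hs
      have : (X : ℤ⟦X⟧) ^ (M + 1) = X ^ (M + 1 - s) * X ^ s := by
        rw [← pow_add]; congr 1; simp at hs; omega
      rw [this]; ring
    rw [Finset.sum_congr rfl key, Finset.sum_add_distrib, Finset.sum_range_succ,
      Finset.sum_range_succ' (fun s => X ^ (M + 1 - s) * (1 - X ^ s) * _)]
    simp only [Nat.sub_self, pow_zero, sub_self, zero_mul, mul_zero, add_zero]
    rw [← Finset.sum_add_distrib]
    refine Finset.sum_congr rfl fun s hs => ?_
    have hs : s ≤ M := by simpa [Nat.lt_succ_iff] using hs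
    obtain ⟨d, rfl⟩ := Nat.exists_eq_add_of_le hs
    have h1 : s + d + 1 - s = d + 1 := by omega
    have h2 : s + d + 1 - (s + 1) = d := by omega
    have h3 : s + d - s = d := by omega
    rw [h1, h2, h3, codimGF_succ]
    rcases le_or_gt L s with h | h
    · have h4 : L - s = 0 := by omega
      have h5 : L - (s + 1) = 0 := by omega
      rw [h4, h5, cardGF_succ d]
      ring
    · obtain ⟨r, rfl⟩ := Nat.exists_eq_add_of_lt h
      have h4 : s + r + 1 - s = r + 1 := by omega
      have h5 : s + r + 1 - (s + 1) = r := by omega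
      rw [h4, h5, cardGF_succ d, cardGF_succ s]
      ring

end Counting

section Fibres

open PowerSeries

/-- Cardinalities and total sum of a pair of multisets. -/
def pairStat (x : Multiset ℕ × Multiset ℕ) : ℕ × ℕ × ℕ :=
  (x.1.card, x.2.card, x.1.sum + x.2.sum)

/-- Quadruples `(α, m, σ, τ)` in which `σ` is a partition into parts at most `m`. -/
abbrev CrankData : Type :=
  {x : Multiset ℕ × ℕ × Multiset ℕ × Multiset ℕ // ∀ y ∈ x.2.2.1, 0 < y ∧ y ≤ x.2.1}

/-- The statistic on `CrankData` corresponding to `pairStat`. -/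
def crankStat (x : CrankData) : ℕ × ℕ × ℕ :=
  (x.1.1.card + x.1.2.1, x.1.1.card + x.1.2.2.2.card,
    x.1.1.sum + (x.1.2.2.1.sum + x.1.2.2.2.sum) + x.1.2.1 * x.1.2.2.2.card)

/-- The pairs of multisets of prescribed cardinalities, as a fibre of `pairStat`. -/
def pairFiberEquiv (M L w : ℕ) :
    {p : {m : Multiset ℕ // m.card = M} × {m : Multiset ℕ // m.card = L} //
      p.1.1.sum + p.2.1.sum = w} ≃ {x // pairStat x = (M, L, w)} where
  toFun p := ⟨(p.1.1.1, p.1.2.1), by simp [pairStat, p.1.1.2, p.1.2.2, p.2]⟩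
  invFun x := ⟨(⟨x.1.1, congrArg (fun t => t.1) x.2⟩, ⟨x.1.2, congrArg (fun t => t.2.1) x.2⟩),
    congrArg (fun t => t.2.2) x.2⟩
  left_inv _ := rfl
  right_inv _ := rfl

lemma finite_pairFiber (v : ℕ × ℕ × ℕ) : Finite {x // pairStat x = v} := by
  obtain ⟨M, L, w⟩ := v
  have := (finiteFibers_card M).prod (finiteFibers_card L) w
  exact Finite.of_equiv _ (pairFiberEquiv M L w)

lemma card_pairFiber (M L w : ℕ) :
    (Nat.card {x // pairStat x = (M, L, w)} : ℤ) = coeff w (cardGF M * cardGF L) := by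
  rw [cardGF, cardGF, ← weightGF_prod (finiteFibers_card M) (finiteFibers_card L), weightGF,
    coeff_mk, Nat.card_congr (pairFiberEquiv M L w)]

/-- Elements of `CrankData` whose first component has `s` parts. -/
abbrev CrankBlock (M L s : ℕ) : Type :=
  {m : Multiset ℕ // m.card = s} × {m : Multiset ℕ // ∀ x ∈ m, 0 < x ∧ x ≤ M - s} ×
    {m : Multiset ℕ // s + m.card = L}

/-- The weight on `CrankBlock` corresponding to the last component of `crankStat`. -/
def crankBlockWeight (M L s : ℕ) (x : CrankBlock M L s) : ℕ :=
  x.1.1.sum + (x.2.1.1.sum + x.2.2.1.sum) + (M - s) * (L - s)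

lemma finiteFibers_codim (L s : ℕ) :
    FiniteFibers fun m : {m : Multiset ℕ // s + m.card = L} => m.1.sum :=
  (finiteFibers_card (L - s)).of_injective
    (fun m => ⟨m.1, by have := m.2; omega⟩)
    (fun _ _ h => by simpa [Subtype.ext_iff] using h) fun _ => rfl

lemma finiteFibers_crankBlockWeight (M L s : ℕ) : FiniteFibers (crankBlockWeight M L s) :=
  ((finiteFibers_card s).prod
    ((finiteFibers_bounded (M - s)).prod (finiteFibers_codim L s))).add_const _

lemma weightGF_crankBlockWeight (M L s : ℕ) :
    weightGF (crankBlockWeight M L s) =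
      X ^ ((M - s) * (L - s)) * (cardGF s * (cardGF (M - s) * codimGF L s)) := by
  rw [← boundedGF_eq_cardGF (M - s), boundedGF, codimGF, cardGF,
    ← weightGF_prod (finiteFibers_bounded (M - s)) (finiteFibers_codim L s),
    ← weightGF_prod (finiteFibers_card s)
      ((finiteFibers_bounded (M - s)).prod (finiteFibers_codim L s)),
    ← weightGF_add_const]
  rfl

/-- Decomposition of a fibre of `crankStat` by the number of parts of the first component. -/
def crankFiberMap (M L w : ℕ)
    (p : {p : Σ s : Fin (M + 1), CrankBlock M L s // crankBlockWeight M L p.1 p.2 = w}) :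
    {x // crankStat x = (M, L, w)} :=
  ⟨⟨(p.1.2.1.1, M - p.1.1, p.1.2.2.1.1, p.1.2.2.2.1), p.1.2.2.1.2⟩, by
    obtain ⟨⟨⟨s, hs⟩, ⟨a, ha⟩, ⟨b, hb⟩, ⟨d, hd⟩⟩, hw⟩ := p
    simp only [crankBlockWeight] at hw ha hb hd
    have h : L - s = d.card := by omega
    rw [h] at hw
    simp only [crankStat, Prod.mk.injEq]
    exact ⟨by omega, by omega, hw⟩⟩

lemma crankFiberMap_bijective (M L w : ℕ) : (crankFiberMap M L w).Bijective := by
  constructor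
  · rintro ⟨⟨⟨s, hs⟩, ⟨a, ha⟩, ⟨b, hb⟩, ⟨d, hd⟩⟩, hw⟩
      ⟨⟨⟨s', hs'⟩, ⟨a', ha'⟩, ⟨b', hb'⟩, ⟨d', hd'⟩⟩, hw'⟩ h
    simp only [crankFiberMap, Subtype.mk.injEq, Prod.mk.injEq] at h
    obtain ⟨rfl, -, rfl, rfl⟩ := h
    dsimp only at ha ha'
    subst ha
    subst ha'
    rfl
  · rintro ⟨⟨⟨a, m, b, d⟩, hb⟩, h⟩
    simp only [crankStat, Prod.mk.injEq] at h hb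
    obtain ⟨h1, h2, h3⟩ := h
    have hm : M - a.card = m := by omega
    have hd : L - a.card = d.card := by omega
    refine ⟨⟨⟨⟨a.card, by omega⟩, ⟨a, rfl⟩, ⟨b, by simpa [hm] using hb⟩, ⟨d, h2⟩⟩, ?_⟩, ?_⟩
    · simp only [crankBlockWeight, hm, hd, h3]
    · simp only [crankFiberMap, hm]

lemma finite_crankFiber (v : ℕ × ℕ × ℕ) : Finite {x // crankStat x = v} := by
  obtain ⟨M, L, w⟩ := v
  have := fun s : Fin (M + 1) => finiteFibers_crankBlockWeight M L s w
  have := Finite.of_equiv _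
    (sigmaFiberwiseEquiv (fun s : Fin (M + 1) => crankBlockWeight M L s) w).symm
  exact Finite.of_surjective _ (crankFiberMap_bijective M L w).2

lemma card_crankFiber (v : ℕ × ℕ × ℕ) :
    Nat.card {x // crankStat x = v} = Nat.card {x // pairStat x = v} := by
  obtain ⟨M, L, w⟩ := v
  rw [← Nat.cast_inj (R := ℤ), card_pairFiber, ← sum_durfee, Finset.sum_range,
    ← Nat.card_congr (Equiv.ofBijective _ (crankFiberMap_bijective M L w))]
  simp only [← weightGF_crankBlockWeight]
  rw [← weightGF_sigma fun s : Fin (M + 1) => finiteFibers_crankBlockWeight M L s, weightGF,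
    coeff_mk]

lemma exists_crankStat_equiv : ∃ e : CrankData ≃ Multiset ℕ × Multiset ℕ,
    ∀ x, pairStat (e x) = crankStat x := by
  have h : ∀ v, Nonempty ({x // crankStat x = v} ≃ {x // pairStat x = v}) := fun v => by
    have := finite_crankFiber v
    have := finite_pairFiber v
    exact Finite.card_eq.1 (card_crankFiber v)
  exact ⟨Equiv.ofFiberEquiv fun v => (h v).some, fun x => Equiv.ofFiberEquiv_map _ x⟩

end Fibres

section Encoding

lemma exists_two_nsmul_of_even_count {m : Multiset ℕ} (h : ∀ x, Even (m.count x)) :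
    ∃ k : Multiset ℕ, m = 2 • k := by
  refine ⟨∑ x ∈ m.toFinset, (m.count x / 2) • {x}, ?_⟩
  conv_lhs => rw [← Multiset.toFinset_sum_count_nsmul_eq m]
  rw [← Finset.sum_nsmul]
  refine Finset.sum_congr rfl fun x _ => ?_
  rw [← mul_nsmul', Nat.mul_div_cancel' (h x).two_dvd]

lemma even_count_two_nsmul (k : Multiset ℕ) (x : ℕ) : Even ((2 • k).count x) := by
  rw [Multiset.count_nsmul]
  exact even_two_mul _

lemma two_nsmul_multiset_injective : (fun k : Multiset ℕ => 2 • k).Injective := fun a b h => by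
  ext x
  have := congrArg (Multiset.count x) h
  simp only [Multiset.count_nsmul] at this
  omega

lemma mem_two_nsmul {k : Multiset ℕ} {x : ℕ} : x ∈ 2 • k ↔ x ∈ k := by
  simp [two_nsmul]

/-- The partition in `EO*` with largest even part `2 * m` encoded by `(m, σ, τ)`. -/
def evenOddPartition (m : ℕ) (σ τ : Multiset ℕ) : Multiset ℕ :=
  (if m = 0 then 0 else {2 * m}) +
    2 • (σ.map (fun j => 2 * j) + τ.map fun j => 2 * (j + m) + 1)

variable {m : ℕ} {σ τ : Multiset ℕ}

lemma mem_evenOddPartition {x : ℕ} : x ∈ evenOddPartition m σ τ ↔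
    (m ≠ 0 ∧ x = 2 * m) ∨ (∃ j ∈ σ, 2 * j = x) ∨ ∃ j ∈ τ, 2 * (j + m) + 1 = x := by
  rw [evenOddPartition, Multiset.mem_add, mem_two_nsmul, Multiset.mem_add, Multiset.mem_map,
    Multiset.mem_map]
  split_ifs with h <;> simp [h]

lemma filter_even_evenOddPartition :
    (evenOddPartition m σ τ).filter (fun x => Even x) =
      (if m = 0 then 0 else {2 * m}) + 2 • σ.map (fun j => 2 * j) := by
  have h1 : (σ.map (fun j => 2 * j)).filter (fun x => Even x) = σ.map (fun j => 2 * j) :=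
    Multiset.filter_eq_self.2 (by simp)
  have h2 : (τ.map fun j => 2 * (j + m) + 1).filter (fun x => Even x) = 0 :=
    Multiset.filter_eq_nil.2 (by simp)
  rw [evenOddPartition, Multiset.filter_add, Multiset.filter_nsmul, Multiset.filter_add, h1, h2,
    add_zero]
  split_ifs <;> simp [Multiset.filter_singleton]

lemma filter_odd_evenOddPartition :
    (evenOddPartition m σ τ).filter (fun x => Odd x) =
      2 • τ.map (fun j => 2 * (j + m) + 1) := by
  have h1 : (σ.map (fun j => 2 * j)).filter (fun x => Odd x) = 0 :=
    Multiset.filter_eq_nil.2 (by simp)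
  have h2 : (τ.map fun j => 2 * (j + m) + 1).filter (fun x => Odd x) =
      τ.map fun j => 2 * (j + m) + 1 :=
    Multiset.filter_eq_self.2 (by simp)
  rw [evenOddPartition, Multiset.filter_add, Multiset.filter_nsmul, Multiset.filter_add, h1, h2,
    zero_add]
  split_ifs <;> simp [Multiset.filter_singleton]

lemma lep_evenOddPartition (h : ∀ y ∈ σ, 0 < y ∧ y ≤ m) :
    lep (evenOddPartition m σ τ) = 2 * m := by
  rw [lep]
  refine le_antisymm (Multiset.sup_le.2 fun x hx => ?_) ?_
  · rw [Multiset.mem_filter, mem_evenOddPartition] at hx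
    obtain ⟨⟨-, rfl⟩ | ⟨j, hj, rfl⟩ | ⟨j, hj, rfl⟩, he⟩ := hx
    · rfl
    · have := h j hj
      omega
    · rw [Nat.even_iff] at he
      omega
  · rcases Nat.eq_zero_or_pos m with rfl | hm
    · simp
    · exact Multiset.le_sup (by simp [mem_evenOddPartition, hm.ne'])

lemma eoc_evenOddPartition (h : ∀ y ∈ σ, 0 < y ∧ y ≤ m) :
    eoc (evenOddPartition m σ τ) = 2 * m - 2 * τ.card := by
  rw [eoc, lep_evenOddPartition h, filter_odd_evenOddPartition]
  simp

lemma sum_evenOddPartition :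
    (evenOddPartition m σ τ).sum =
      2 * m + 4 * (σ.sum + τ.sum + m * τ.card) + 2 * τ.card := by
  have h : (if m = 0 then 0 else {2 * m} : Multiset ℕ).sum = 2 * m := by
    split_ifs with h <;> simp [h]
  have h' : (σ.map fun j => 2 * j).sum = 2 * σ.sum := by
    rw [Multiset.sum_map_mul_left, Multiset.map_id']
  rw [evenOddPartition, Multiset.sum_add, h, Multiset.sum_nsmul, Multiset.sum_add, h']
  simp only [Multiset.sum_map_mul_left, Multiset.sum_map_add, Multiset.map_id',
    Multiset.map_const', Multiset.sum_replicate, smul_eq_mul, mul_one]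
  ring

lemma eoStar_evenOddPartition (h : ∀ y ∈ σ, 0 < y ∧ y ≤ m) :
    EOStar (evenOddPartition m σ τ) := by
  have pos : IsPartition (evenOddPartition m σ τ) := by
    intro x hx
    rw [mem_evenOddPartition] at hx
    obtain ⟨hm, rfl⟩ | ⟨j, hj, rfl⟩ | ⟨j, hj, rfl⟩ := hx
    · omega
    · have := h j hj
      omega
    · omega
  refine ⟨pos, ?_, ?_, ?_⟩
  · intro x hx y hy he ho
    rw [mem_evenOddPartition] at hx hy
    rw [Nat.even_iff] at he
    rw [Nat.odd_iff] at ho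
    have hx' : x ≤ 2 * m := by
      obtain ⟨-, rfl⟩ | ⟨j, hj, rfl⟩ | ⟨j, hj, rfl⟩ := hx
      · rfl
      · have := h j hj
        omega
      · omega
    obtain ⟨-, rfl⟩ | ⟨j, hj, rfl⟩ | ⟨j, hj, rfl⟩ := hy <;> omega
  · intro x hx hne
    rw [lep_evenOddPartition h] at hne
    rw [evenOddPartition, Multiset.count_add, Nat.even_add]
    refine iff_of_true ?_ (even_count_two_nsmul _ _)
    split_ifs <;> simp [hne]
  · intro x hx heq
    rw [lep_evenOddPartition h] at heq
    have := pos x hx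
    have hm : m ≠ 0 := by omega
    rw [evenOddPartition, Multiset.count_add, if_neg hm, heq, Multiset.count_singleton_self]
    exact odd_one.add_even (even_count_two_nsmul _ _)

lemma EOStar.exists_eq_evenOddPartition {ν : Multiset ℕ} (hν : EOStar ν) :
    ∃ m σ τ, (∀ y ∈ σ, 0 < y ∧ y ≤ m) ∧ evenOddPartition m σ τ = ν := by
  obtain ⟨hpos, hlt, heven, hodd⟩ := hν
  have hle : ∀ x ∈ ν, Even x → x ≤ lep ν := fun x hx he =>
    Multiset.le_sup (Multiset.mem_filter.2 ⟨hx, he⟩)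
  have hmem : lep ν = 0 ∨ lep ν ∈ ν.filter (fun x => Even x) := by
    by_contra! hcon
    obtain ⟨h0, hn⟩ := hcon
    have : lep ν ≤ lep ν - 1 := Multiset.sup_le.2 fun x hx => by
      have h1 := Multiset.le_sup hx
      have h2 : x ≠ lep ν := fun h => hn (h ▸ hx)
      rw [← lep] at h1
      omega
    omega
  obtain ⟨m, hm⟩ : ∃ m, lep ν = 2 * m := by
    rcases hmem with h | h
    · exact ⟨0, h⟩
    · exact (Multiset.mem_filter.1 h).2.exists_two_nsmul _ |>.imp fun _ h => by simpa using h
  obtain ⟨k, hk⟩ : ∃ k, ν = (if m = 0 then 0 else {2 * m}) + 2 • k := by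
    split_ifs with h0
    · simp only [zero_add]
      refine exists_two_nsmul_of_even_count fun x => ?_
      by_cases hx : x ∈ ν
      · exact heven x hx (by have := hpos x hx; omega)
      · simp [Multiset.count_eq_zero_of_notMem hx]
    · have hmν : 2 * m ∈ ν := by
        rcases hmem with h | h
        · omega
        · exact hm ▸ (Multiset.mem_filter.1 h).1
      obtain ⟨ρ, rfl⟩ := Multiset.exists_cons_of_mem hmν
      obtain ⟨k, rfl⟩ : ∃ k : Multiset ℕ, ρ = 2 • k := by
        refine exists_two_nsmul_of_even_count fun x => ?_
        by_cases hx : x = 2 * m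
        · have := hodd x (hx ▸ hmν) (by omega)
          subst hx
          rw [Multiset.count_cons_self] at this
          simpa [Nat.odd_add_one] using this
        · by_cases hxρ : x ∈ ρ
          · have := heven x (Multiset.mem_cons_of_mem hxρ) (by omega)
            rwa [Multiset.count_cons_of_ne hx] at this
          · simp [Multiset.count_eq_zero_of_notMem hxρ]
      exact ⟨k, by simp⟩
  have hkν : ∀ x ∈ k, x ∈ ν := fun x hx => by
    rw [hk]
    exact Multiset.mem_add.2 (.inr (mem_two_nsmul.2 hx))
  have hkodd : ∀ x ∈ k, Odd x → 2 * m < x := fun x hx ho => by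
    rcases hmem with h | h
    · have := hpos x (hkν x hx)
      omega
    · rw [← hm]
      exact hlt _ (Multiset.mem_filter.1 h).1 x (hkν x hx) (Multiset.mem_filter.1 h).2 ho
  refine ⟨m, (k.filter (fun x => Even x)).map (· / 2),
    (k.filter (fun x => ¬ Even x)).map (fun x => x / 2 - m), ?_, ?_⟩
  · intro y hy
    obtain ⟨x, hx, rfl⟩ := Multiset.mem_map.1 hy
    obtain ⟨hx, he⟩ := Multiset.mem_filter.1 hx
    have h1 := hpos x (hkν x hx)
    have h2 := hle x (hkν x hx) he
    rw [Nat.even_iff] at he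
    omega
  · rw [evenOddPartition, Multiset.map_map, Multiset.map_map]
    conv_rhs => rw [hk, ← Multiset.filter_add_not (fun x => Even x) k]
    congr 3
    · conv_rhs => rw [← Multiset.map_id (k.filter _)]
      refine Multiset.map_congr rfl fun x hx => ?_
      have he := (Multiset.mem_filter.1 hx).2
      rw [Nat.even_iff] at he
      simp only [Function.comp_apply, id]
      omega
    · conv_rhs => rw [← Multiset.map_id (k.filter _)]
      refine Multiset.map_congr rfl fun x hx => ?_
      obtain ⟨hx, ho⟩ := Multiset.mem_filter.1 hx
      rw [Nat.not_even_iff_odd] at ho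
      have := hkodd x hx ho
      rw [Nat.odd_iff] at ho
      simp only [Function.comp_apply, id]
      omega

/-- The pair of partitions in `E* × EO*` encoded by an element of `CrankData`. -/
def crankPair (x : CrankData) : Multiset ℕ × Multiset ℕ :=
  (2 • x.1.1.map (fun j => 2 * (j + 1)), evenOddPartition x.1.2.1 x.1.2.2.1 x.1.2.2.2)

lemma crankPair_injective : crankPair.Injective := by
  rintro ⟨⟨a, m, b, d⟩, hb⟩ ⟨⟨a', m', b', d'⟩, hb'⟩ h
  simp only [crankPair, Prod.mk.injEq] at h hb hb'
  obtain ⟨h1, h2⟩ := h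
  have ha : a = a' :=
    Multiset.map_injective (fun i j h => by omega)
      (two_nsmul_multiset_injective h1)
  have hm : m = m' := by
    have := congrArg lep h2
    rw [lep_evenOddPartition hb, lep_evenOddPartition hb'] at this
    omega
  subst ha hm
  have he := congrArg (Multiset.filter (fun x => Even x)) h2
  have ho := congrArg (Multiset.filter (fun x => Odd x)) h2
  rw [filter_even_evenOddPartition, filter_even_evenOddPartition] at he
  rw [filter_odd_evenOddPartition, filter_odd_evenOddPartition] at ho
  have h3 : b = b' :=
    Multiset.map_injective (fun i j h => by omega)
      (two_nsmul_multiset_injective (add_left_cancel he))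
  have h4 : d = d' :=
    Multiset.map_injective (fun i j h => by omega)
      (two_nsmul_multiset_injective ho)
  subst h3 h4
  rfl

lemma EStar.exists_eq {μ : Multiset ℕ} (hμ : EStar μ) :
    ∃ a : Multiset ℕ, 2 • a.map (fun j => 2 * (j + 1)) = μ := by
  obtain ⟨hpos, heven, hcount⟩ := hμ
  obtain ⟨k, rfl⟩ := exists_two_nsmul_of_even_count hcount
  refine ⟨k.map (fun x => x / 2 - 1), ?_⟩
  rw [Multiset.map_map]
  congr 1
  conv_rhs => rw [← Multiset.map_id k]
  refine Multiset.map_congr rfl fun x hx => ?_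
  have h1 := hpos x (mem_two_nsmul.2 hx)
  have h2 := heven x (mem_two_nsmul.2 hx)
  rw [Nat.even_iff] at h2
  simp only [Function.comp_apply, id]
  omega

lemma eStar_two_nsmul_map (a : Multiset ℕ) : EStar (2 • a.map (fun j => 2 * (j + 1))) := by
  refine ⟨fun x hx => ?_, fun x hx => ?_, even_count_two_nsmul _⟩ <;>
  · obtain ⟨j, -, rfl⟩ := Multiset.mem_map.1 (mem_two_nsmul.1 hx)
    simp

/-- The size and the crank expressed through `pairStat` or `crankStat`. -/
def StatCondition (n : ℕ) (c : ℤ) (v : ℕ × ℕ × ℕ) : Prop :=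
  2 * v.1 + 2 * v.2.1 + 4 * v.2.2 = n ∧ 2 * (v.1 : ℤ) - 2 * v.2.1 = c

lemma image_crankPair (n : ℕ) (c : ℤ) :
    crankPair '' {x | StatCondition n c (crankStat x)} =
      {p : Multiset ℕ × Multiset ℕ |
        EStar p.1 ∧ EOStar p.2 ∧ eoc p.2 = c ∧ p.1.sum + p.2.sum = n} := by
  have key : ∀ x : CrankData, StatCondition n c (crankStat x) ↔
      eoc (crankPair x).2 = c ∧ (crankPair x).1.sum + (crankPair x).2.sum = n := by
    rintro ⟨⟨a, m, b, d⟩, hb⟩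
    have hs : (2 • a.map (fun j => 2 * (j + 1))).sum = 4 * a.sum + 4 * a.card := by
      simp only [Multiset.sum_nsmul, Multiset.sum_map_mul_left, Multiset.sum_map_add,
        Multiset.map_id', Multiset.map_const', Multiset.sum_replicate, smul_eq_mul, mul_one]
      ring
    simp only [StatCondition, crankStat, crankPair]
    rw [eoc_evenOddPartition hb, sum_evenOddPartition, hs, and_comm]
    push_cast
    refine and_congr ?_ ?_
    · constructor <;> intro h <;> linarith
    · constructor <;> intro h <;> linarith
  ext p
  constructor
  · rintro ⟨x, hx, rfl⟩
    exact ⟨eStar_two_nsmul_map _, eoStar_evenOddPartition x.2, (key x).1 hx⟩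
  · obtain ⟨μ, ν⟩ := p
    rintro ⟨h1, h2, h3⟩
    obtain ⟨a, rfl⟩ := h1.exists_eq
    obtain ⟨m, b, d, hb, rfl⟩ := h2.exists_eq_evenOddPartition
    exact ⟨⟨(a, m, b, d), hb⟩, (key _).2 h3, rfl⟩

/-- Send every entry `i` of a pair of multisets to `4 * i + 2`. -/
def twoModFourPair (x : Multiset ℕ × Multiset ℕ) : Multiset ℕ × Multiset ℕ :=
  (x.1.map (fun i => 4 * i + 2), x.2.map (fun i => 4 * i + 2))

lemma twoModFourPair_injective : twoModFourPair.Injective := by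
  have h : (fun i : ℕ => 4 * i + 2).Injective := fun i j h => by dsimp only at h; omega
  exact (Multiset.map_injective h).prodMap (Multiset.map_injective h)

lemma exists_map_eq_of_mod_four {m : Multiset ℕ} (h : ∀ x ∈ m, x % 4 = 2) :
    ∃ a : Multiset ℕ, a.map (fun i => 4 * i + 2) = m := by
  refine ⟨m.map (· / 4), ?_⟩
  rw [Multiset.map_map]
  conv_rhs => rw [← Multiset.map_id m]
  refine Multiset.map_congr rfl fun x hx => ?_
  have := h x hx
  simp only [Function.comp_apply, id]
  omega

lemma image_twoModFourPair (n : ℕ) (c : ℤ) :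
    twoModFourPair '' {x | StatCondition n c (pairStat x)} =
      {p : Multiset ℕ × Multiset ℕ |
        (∀ x ∈ p.1, x % 4 = 2) ∧ (∀ x ∈ p.2, x % 4 = 2) ∧
        p.1.sum + p.2.sum = n ∧
        2 * (Multiset.card p.1 : ℤ) - 2 * (Multiset.card p.2 : ℤ) = c} := by
  have key : ∀ x, StatCondition n c (pairStat x) ↔
      (twoModFourPair x).1.sum + (twoModFourPair x).2.sum = n ∧
      2 * (Multiset.card (twoModFourPair x).1 : ℤ) -
        2 * (Multiset.card (twoModFourPair x).2 : ℤ) = c := by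
    rintro ⟨a, b⟩
    have hs : ∀ m : Multiset ℕ, (m.map fun i => 4 * i + 2).sum = 4 * m.sum + 2 * m.card := by
      intro m
      rw [Multiset.sum_map_add, Multiset.sum_map_mul_left, Multiset.map_id', Multiset.map_const',
        Multiset.sum_replicate, smul_eq_mul, mul_comm 2]
    simp only [StatCondition, pairStat, twoModFourPair, Multiset.card_map, hs]
    refine and_congr_left fun _ => ?_
    constructor <;> intro h <;> linarith
  have hmod : ∀ a : Multiset ℕ, ∀ x ∈ a.map (fun i => 4 * i + 2), x % 4 = 2 := by
    intro a x hx
    obtain ⟨i, -, rfl⟩ := Multiset.mem_map.1 hx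
    omega
  ext p
  constructor
  · rintro ⟨x, hx, rfl⟩
    exact ⟨hmod _, hmod _, (key x).1 hx⟩
  · obtain ⟨l, r⟩ := p
    rintro ⟨h1, h2, h3⟩
    obtain ⟨a, rfl⟩ := exists_map_eq_of_mod_four h1
    obtain ⟨b, rfl⟩ := exists_map_eq_of_mod_four h2
    exact ⟨(a, b), (key _).2 h3, rfl⟩

end Encoding

/-- Coefficient-wise form of Andrews' identity (2): for every positive integer `n` and
integer `c`, the number of pairs `(μ, ν)` with `μ ∈ E*`, `ν ∈ EO*`, `eoc ν = c` and
`|μ| + |ν| = n` equals the number of pairs `(λ, π)` of partitions into parts `≡ 2 (mod 4)`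
with `|λ| + |π| = n` and `2 ℓ(λ) - 2 ℓ(π) = c`. -/
theorem stmt4 (n : ℕ) (hn : 0 < n) (c : ℤ) :
    {p : Multiset ℕ × Multiset ℕ |
      EStar p.1 ∧ EOStar p.2 ∧ eoc p.2 = c ∧ p.1.sum + p.2.sum = n}.ncard =
    {p : Multiset ℕ × Multiset ℕ |
      (∀ x ∈ p.1, x % 4 = 2) ∧ (∀ x ∈ p.2, x % 4 = 2) ∧
      p.1.sum + p.2.sum = n ∧
      2 * (Multiset.card p.1 : ℤ) - 2 * (Multiset.card p.2 : ℤ) = c}.ncard := by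
  obtain ⟨e, he⟩ := exists_crankStat_equiv
  rw [← image_crankPair, ← image_twoModFourPair,
    Set.ncard_image_of_injective _ crankPair_injective,
    Set.ncard_image_of_injective _ twoModFourPair_injective]
  exact Nat.card_congr (e.subtypeEquiv fun x => by simp [he])
end
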